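/- arXiv:math/0612409 — 5 statements merged into one kernel-verified Lean document; each statement's English description precedes it below -/
import Mathlib

section
/- Let S_+ be a finite set with h = |S_+| ≥ 2, F the free group on S_+, r ∈ F a nontrivial cyclically reduced element, and Γ = F/⟨⟨r⟩⟩ the corresponding one-relator group. Assume the images in Γ of the 2h elements of S_+ ∪ S_+⁻¹ are pairwise distinct and nontrivial, and let S ⊆ Γ be this symmetric generating set with 2h elements. Then √(2h−1)/h < μ(Γ,S) ≤ (√(2h−3) + 1)/h. -/
noncomputable section

/-- A reduced word is cyclically reduced if its last letter is not the inverse of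
its first letter (so that all its cyclic permutations are again reduced). -/
def CyclicallyReduced {α : Type*} [DecidableEq α] (w : FreeGroup α) : Prop :=
  ∀ (a : α) (b : Bool), w.toWord.head? = some (a, b) → w.toWord.getLast? ≠ some (a, !b)

/-- The symmetrized closure `R*` of a set `R` of relators: all cyclic permutations of
elements of `R` and of their inverses. -/
def SymmClosure {α : Type*} [DecidableEq α] (R : Set (FreeGroup α)) : Set (FreeGroup α) :=
  {w | ∃ r ∈ R, ∃ n : ℕ,
    w = FreeGroup.mk (r.toWord.rotate n) ∨ w = (FreeGroup.mk (r.toWord.rotate n))⁻¹}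

/-- A piece relative to `R*`: a nonempty reduced word occurring as a common initial
segment of two distinct elements of `R*`. -/
def IsPiece {α : Type*} [DecidableEq α] (R : Set (FreeGroup α)) (p : FreeGroup α) : Prop :=
  p ≠ 1 ∧ ∃ r₁ ∈ SymmClosure R, ∃ r₂ ∈ SymmClosure R, r₁ ≠ r₂ ∧
    p.toWord <+: r₁.toWord ∧ p.toWord <+: r₂.toWord

/-- The small cancellation condition `C'(1/6)`: the relators are cyclically reduced and
every piece `p` which is an initial segment of some `r ∈ R*` satisfies `|p| < |r|/6`. -/
def SmallCancellationSixth {α : Type*} [DecidableEq α] (R : Set (FreeGroup α)) : Prop :=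
  (∀ r ∈ R, CyclicallyReduced r) ∧
  ∀ r ∈ SymmClosure R, ∀ p : FreeGroup α, IsPiece R p → p.toWord <+: r.toWord →
    6 * p.toWord.length < r.toWord.length

namespace FreeGroup

open List

section Rewriting

universe u

variable {X : Type u} [DecidableEq X]

/-- The exponent sum of a word, each letter `a` being counted with weight `c a`. -/
def weightSum (c : X → ℤ) (L : List (X × Bool)) : ℤ :=
  (L.map fun p => cond p.2 (c p.1) (-c p.1)).sum

/-- Reidemeister–Schreier rewriting of a word, starting at level `k`: a letter `a ≠ s` is replaced
by its copy at the current level, `s` is erased, and every letter `a` raises the level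
by `c a`. -/
def levelRewrite (s : X) (c : X → ℤ) : ℤ → List (X × Bool) → List ((X × ℤ) × Bool)
  | _, [] => []
  | k, (a, true) :: L =>
    if a = s then levelRewrite s c (k + c a) L
    else ((a, k), true) :: levelRewrite s c (k + c a) L
  | k, (a, false) :: L =>
    if a = s then levelRewrite s c (k - c a) L
    else ((a, k - c a), false) :: levelRewrite s c (k - c a) L

variable {s : X} {c : X → ℤ}

omit [DecidableEq X] in
theorem mk_cons (p : X × Bool) (L : List (X × Bool)) :
    mk (p :: L) = cond p.2 (of p.1) (of p.1)⁻¹ * mk L := by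
  obtain ⟨a, _ | _⟩ := p <;> simp [of, mul_mk, invRev]

omit [DecidableEq X] in
theorem weightSum_cons (p : X × Bool) (L : List (X × Bool)) :
    weightSum c (p :: L) = cond p.2 (c p.1) (-c p.1) + weightSum c L := by
  simp [weightSum]

theorem levelRewrite_append (k : ℤ) (L₁ L₂ : List (X × Bool)) :
    levelRewrite s c k (L₁ ++ L₂) =
      levelRewrite s c k L₁ ++ levelRewrite s c (k + weightSum c L₁) L₂ := by
  induction L₁ generalizing k with
  | nil => simp [levelRewrite, weightSum]
  | cons p L₁ ih =>
    obtain ⟨a, _ | _⟩ := p <;> by_cases h : a = s <;>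
      simp [levelRewrite, h, ih, weightSum_cons, ← add_assoc, sub_eq_add_neg]

theorem length_levelRewrite_le (k : ℤ) (L : List (X × Bool)) :
    (levelRewrite s c k L).length ≤ L.length := by
  induction L generalizing k with
  | nil => simp [levelRewrite]
  | cons p L ih =>
    have h₁ := ih (k + c p.1)
    have h₂ := ih (k - c p.1)
    obtain ⟨a, _ | _⟩ := p <;> by_cases h : a = s <;> simp [levelRewrite, h] at * <;> omega

theorem length_levelRewrite_lt {L : List (X × Bool)} (hs : ∃ b, (s, b) ∈ L) (k : ℤ) :
    (levelRewrite s c k L).length < L.length := by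
  obtain ⟨b, hb⟩ := hs
  obtain ⟨L₁, L₂, rfl⟩ := List.append_of_mem hb
  have h₁ := length_levelRewrite_le (s := s) (c := c) k L₁
  have h₂ := fun j => length_levelRewrite_le (s := s) (c := c) j L₂
  cases b <;> simp only [levelRewrite_append, levelRewrite, if_true, length_append, length_cons]
  · have := h₂ (k + weightSum c L₁ - c s); omega
  · have := h₂ (k + weightSum c L₁ + c s); omega

theorem exists_mem_of_mem_levelRewrite {L : List (X × Bool)} {k : ℤ} {a : X} {i : ℤ} {b : Bool}
    (h : ((a, i), b) ∈ levelRewrite s c k L) : a ≠ s ∧ (a, b) ∈ L := by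
  induction L generalizing k with
  | nil => simp [levelRewrite] at h
  | cons p L ih =>
    obtain ⟨a', _ | _⟩ := p <;> by_cases h' : a' = s <;> simp [levelRewrite, h'] at h <;> grind

theorem exists_mem_levelRewrite {L : List (X × Bool)} {a : X} {b : Bool} (has : a ≠ s)
    (h : (a, b) ∈ L) (k : ℤ) : ∃ i, ((a, i), b) ∈ levelRewrite s c k L := by
  obtain ⟨L₁, L₂, rfl⟩ := List.append_of_mem h
  cases b <;> simp only [levelRewrite_append, levelRewrite, if_neg has, mem_append, mem_cons]
  · exact ⟨_, .inr (.inl rfl)⟩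
  · exact ⟨_, .inr (.inl rfl)⟩

theorem head?_levelRewrite {L : List (X × Bool)} (hL : IsReduced L) {k : ℤ} {a : X} {j : ℤ}
    {b : Bool} (h : (levelRewrite s c k L).head? = some ((a, j), b)) :
    ∃ n : ℤ, j = k + n * c s + cond b 0 (-c a) ∧ (n = 0 → L.head? = some (a, b)) ∧
      (n ≠ 0 → L.head? = some (s, decide (0 < n))) := by
  induction L generalizing k with
  | nil => simp [levelRewrite] at h
  | cons p L ih =>
    have hL' : IsReduced L := hL.tail
    have hhead := (List.isChain_cons.1 hL).1
    obtain ⟨a', b'⟩ := p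
    by_cases h' : a' = s
    · subst h'
      cases b' <;> simp only [levelRewrite, if_true] at h
      · obtain ⟨n, rfl, h₀, h₁⟩ := ih hL' h
        refine ⟨n - 1, by ring, ?_, ?_⟩
        · intro hn
          have := h₁ (by omega)
          have := hhead _ this rfl
          simp at this; omega
        · intro hn
          by_cases hn0 : n = 0
          · simp [hn0]
          · have := hhead _ (h₁ hn0) rfl
            simp at this; simp; omega
      · obtain ⟨n, rfl, h₀, h₁⟩ := ih hL' h
        refine ⟨n + 1, by ring, ?_, ?_⟩
        · intro hn
          have := h₁ (by omega)
          have := hhead _ this rfl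
          simp at this; omega
        · intro hn
          by_cases hn0 : n = 0
          · simp [hn0]
          · have := hhead _ (h₁ hn0) rfl
            simp at this; simp; omega
    · refine ⟨0, ?_⟩
      cases b' <;> simp [levelRewrite, h'] at h <;> grind

theorem IsReduced.levelRewrite (hc : c s ≠ 0) {L : List (X × Bool)} (hL : IsReduced L) (k : ℤ) :
    IsReduced (levelRewrite s c k L) := by
  induction L generalizing k with
  | nil => simp [FreeGroup.levelRewrite]
  | cons p L ih =>
    have hL' : IsReduced L := hL.tail
    have hhead := (List.isChain_cons.1 hL).1
    obtain ⟨a, b⟩ := p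
    by_cases h : a = s
    · cases b <;> simpa [FreeGroup.levelRewrite, h] using ih hL' _
    · have hlevel {j i : ℤ} {b' : Bool}
          (hmem : (FreeGroup.levelRewrite s c i L).head? = some ((a, j), b'))
          (hj : b' ≠ b → j = i + cond b' 0 (-c a)) : b = b' := by
        by_contra hb
        obtain ⟨n, hj', h₀, -⟩ := head?_levelRewrite hL' hmem
        have : n * c s = 0 := by linarith [hj (Ne.symm hb)]
        exact hb (hhead _ (h₀ ((mul_eq_zero.1 this).resolve_right hc)) rfl)
      cases b <;> simp only [FreeGroup.levelRewrite, h, if_false] <;>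
        refine List.isChain_cons.2 ⟨?_, ih hL' _⟩ <;> rintro ⟨⟨a', j⟩, b'⟩ hmem heq <;>
        obtain ⟨rfl, rfl⟩ := Prod.mk.inj heq <;> refine hlevel hmem ?_ <;> cases b' <;> simp

omit [DecidableEq X] in
theorem IsCyclicallyReduced.append_self_iff {L : List (X × Bool)} :
    IsCyclicallyReduced L ↔ IsReduced (L ++ L) := by
  rw [IsReduced, List.isChain_append, isCyclicallyReduced_iff]
  exact ⟨fun h => ⟨h.1, h.1, h.2⟩, fun h => ⟨h.1, h.2.2⟩⟩

theorem IsCyclicallyReduced.levelRewrite (hc : c s ≠ 0) {L : List (X × Bool)}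
    (hL : IsCyclicallyReduced L) (h0 : weightSum c L = 0) (k : ℤ) :
    IsCyclicallyReduced (levelRewrite s c k L) := by
  rw [append_self_iff] at hL ⊢
  simpa [levelRewrite_append, h0] using hL.levelRewrite hc k

omit [DecidableEq X] in
theorem IsReduced.eq_replicate {L : List (X × Bool)} (hL : IsReduced L)
    (h : ∀ p ∈ L, p.1 = s) : ∃ b, L = List.replicate L.length (s, b) := by
  induction L with
  | nil => simp
  | cons p L ih =>
    obtain ⟨b, hb⟩ := ih hL.tail fun q hq => h q (by simp [hq])
    have hp := h p (by simp)
    refine ⟨p.2, ?_⟩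
    rcases L with _ | ⟨q, L⟩
    · simp [← hp]
    · have hq := h q (by simp)
      have hpq := (isReduced_cons_cons.1 hL).1 (hp.trans hq.symm)
      have : q.2 = b := by
        simp only [length_cons, replicate_succ, cons.injEq] at hb
        rw [hb.1]
      rw [length_cons, replicate_succ, hpq, this, ← hb, ← hp, ← this, ← hpq]

theorem eq_nil_of_levelRewrite_eq_nil (hc : c s ≠ 0) {L : List (X × Bool)} (hL : IsReduced L)
    {k : ℤ} (h : levelRewrite s c k L = []) (h0 : weightSum c L = 0) : L = [] := by
  obtain ⟨b, hb⟩ := hL.eq_replicate (s := s) fun p hp => by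
    by_contra hps
    obtain ⟨i, hi⟩ := exists_mem_levelRewrite (c := c) hps hp k
    simp [h] at hi
  rw [hb, weightSum] at h0
  cases b <;> simpa [hc] using h0

theorem zpow_mul_lift_mk {G : Type*} [Group G] (Φ : FreeGroup X →* G) (g : FreeGroup (X × ℤ) →* G)
    (T : G) (hs : Φ (of s) = T ^ c s) {k : ℤ} {L : List (X × Bool)}
    (h : ∀ a i b, ((a, i), b) ∈ levelRewrite s c k L →
      T ^ i * Φ (of a) = g (of (a, i)) * T ^ (i + c a)) :
    T ^ k * Φ (mk L) = g (mk (levelRewrite s c k L)) * T ^ (k + weightSum c L) := by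
  induction L generalizing k with
  | nil => simp [levelRewrite, weightSum, ← one_eq_mk]
  | cons p L ih =>
    rw [mk_cons, weightSum_cons, _root_.map_mul, ← mul_assoc]
    obtain ⟨a, b⟩ := p
    by_cases has : a = s
    · subst has
      cases b
      · simp only [levelRewrite, if_true] at h ⊢
        simp only [cond_false, _root_.map_inv, hs, ← zpow_neg, ← zpow_add, ← sub_eq_add_neg, ih h]
        congr 2; ring
      · simp only [levelRewrite, if_true] at h ⊢
        simp only [cond_true, hs, ← zpow_add, ih h]
        congr 2; ring
    · cases b
      · simp only [levelRewrite, has, if_false] at h ⊢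
        have h₁ := h a (k - c a) false (by simp)
        have h₂ : T ^ k * (Φ (of a))⁻¹ = (g (of (a, k - c a)))⁻¹ * T ^ (k - c a) := by
          rw [eq_inv_mul_iff_mul_eq, ← mul_assoc, mul_inv_eq_iff_eq_mul, h₁, sub_add_cancel]
        simp only [cond_false, _root_.map_inv, h₂]
        rw [mul_assoc, ih fun a' i b' h' => h a' i b' (by simp [h']), mk_cons]
        simp only [cond_false, _root_.map_mul, _root_.map_inv, mul_assoc]
        congr 3; ring
      · simp only [levelRewrite, has, if_false] at h ⊢
        simp only [cond_true, h a k true (by simp)]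
        rw [mul_assoc, ih fun a' i b' h' => h a' i b' (by simp [h']), mk_cons]
        simp only [cond_true, _root_.map_mul, mul_assoc]
        congr 3; ring

end Rewriting

end FreeGroup

namespace FreeGroup

open List Subgroup

section Freiheitssatz

universe u

variable {X : Type u}

/-- Modulo `N`, the generators other than `x` freely generate a free group: no nonempty reduced
word avoiding `x` lies in `N`. -/
def IsFreeAvoiding (N : Subgroup (FreeGroup X)) (x : X) : Prop :=
  ∀ L : List (X × Bool), IsReduced L → (∀ p ∈ L, p.1 ≠ x) → mk L ∈ N → L = []

theorem IsFreeAvoiding.injective {N : Subgroup (FreeGroup X)} [N.Normal] {x : X}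
    (h : IsFreeAvoiding N x) :
    Function.Injective ((QuotientGroup.mk' N).comp (map (Subtype.val : {a // a ≠ x} → X))) := by
  classical
  rw [injective_iff_map_eq_one]
  intro w hw
  have hred : IsReduced (w.toWord.map fun p => (p.1.1, p.2)) := by
    refine (List.isChain_map _).2 (List.IsChain.imp ?_ (isReduced_toWord (x := w)))
    intro p q hpq h'
    exact hpq (Subtype.ext h')
  have hmem : mk (w.toWord.map fun p => (p.1.1, p.2)) ∈ N := by
    rw [← map.mk, mk_toWord]
    simpa [QuotientGroup.eq_one_iff] using hw
  have := h _ hred (by simp only [List.mem_map]; rintro _ ⟨p, -, rfl⟩; exact p.1.2) hmem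
  rwa [List.map_eq_nil_iff, toWord_eq_nil_iff] at this

theorem IsFreeAvoiding.exists_stable_letter {N : Subgroup (FreeGroup X)} [N.Normal] {x : X}
    (β : Equiv.Perm X) (h₁ : IsFreeAvoiding N x) (h₂ : IsFreeAvoiding N (β x)) :
    ∃ (G : Type u) (_ : Group G) (T : G) (g : FreeGroup X →* G) (ε : G →* Multiplicative ℤ),
      (∀ w, g w = 1 ↔ w ∈ N) ∧ (∀ a ≠ x, T * g (of a) = g (of (β a)) * T) ∧
      ε T = Multiplicative.ofAdd 1 ∧ ∀ w, ε (g w) = 1 := by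
  let e : {a // a ≠ x} ≃ {a // a ≠ β x} :=
    β.subtypeEquiv fun a => by simp
  let φ := (MonoidHom.ofInjective h₁.injective).symm.trans
    ((freeGroupCongr e).trans (MonoidHom.ofInjective h₂.injective))
  let ε : HNNExtension (FreeGroup X ⧸ N) _ _ φ →* Multiplicative ℤ :=
    HNNExtension.lift 1 (Multiplicative.ofAdd 1) (by simp)
  refine ⟨HNNExtension _ _ _ φ, inferInstance, HNNExtension.t,
    HNNExtension.of.comp (QuotientGroup.mk' N), ε, fun w => ?_, fun a ha => ?_, ?_, fun w => ?_⟩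
  · rw [MonoidHom.comp_apply, map_eq_one_iff _ (HNNExtension.of_injective φ)]
    simp [QuotientGroup.eq_one_iff]
  · have := HNNExtension.t_mul_of (φ := φ) (MonoidHom.ofInjective h₁.injective (of ⟨a, ha⟩))
    simpa [φ, e, MonoidHom.ofInjective_apply] using this
  · simp [ε]
  · simp [ε]

/-- The permutation of the levelled letters shifting all levels by one, except that the levels
`m, …, M` of the letter `y` are permuted cyclically and its other levels are fixed. -/
def levelShift [DecidableEq X] (y : X) {m M : ℤ} (h : m ≤ M) : Equiv.Perm (X × ℤ) where
  toFun p := if p.1 = y then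
    (if p.2 = M then (y, m) else if m ≤ p.2 ∧ p.2 < M then (y, p.2 + 1) else p) else (p.1, p.2 + 1)
  invFun p := if p.1 = y then
    (if p.2 = m then (y, M) else if m < p.2 ∧ p.2 ≤ M then (y, p.2 - 1) else p) else (p.1, p.2 - 1)
  left_inv p := by
    obtain ⟨a, i⟩ := p
    by_cases ha : a = y <;> grind
  right_inv p := by
    obtain ⟨a, i⟩ := p
    by_cases ha : a = y <;> grind

variable [DecidableEq X] {s x y : X} {c : X → ℤ} {L : List (X × Bool)}

theorem exists_extension_of_levelRewrite (h0 : weightSum c L = 0) (hys : y ≠ s)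
    (hyL : ∃ b, (y, b) ∈ L)
    (hfree : ∀ p b, (p, b) ∈ levelRewrite s c 0 L →
      IsFreeAvoiding (normalClosure {mk (levelRewrite s c 0 L)}) p) :
    ∃ m M : ℤ, (∃ b, ((y, m), b) ∈ levelRewrite s c 0 L) ∧
      (∃ b, ((y, M), b) ∈ levelRewrite s c 0 L) ∧
      (∀ i b, ((y, i), b) ∈ levelRewrite s c 0 L → m ≤ i ∧ i ≤ M) ∧
      ∃ (G : Type u) (_ : Group G) (T : G) (g : FreeGroup (X × ℤ) →* G) (Φ : FreeGroup X →* G)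
        (ε : G →* Multiplicative ℤ),
        (∀ w, g w = 1 → w ∈ normalClosure {mk (levelRewrite s c 0 L)}) ∧
        ε T = Multiplicative.ofAdd 1 ∧ (∀ w, ε (g w) = 1) ∧
        (∀ w ∈ normalClosure {mk L}, Φ w = 1) ∧ Φ (of s) = T ^ c s ∧
        ∀ a ≠ s, ∀ k : ℤ, (a = y → m ≤ k ∧ k ≤ M) →
          T ^ k * Φ (of a) = g (of (a, k)) * T ^ (k + c a) := by
  set L' := levelRewrite s c 0 L with hL'
  have hfin : {i : ℤ | ∃ b, ((y, i), b) ∈ L'}.Finite := by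
    refine ((L'.map fun p => p.1.2).toFinset.finite_toSet).subset ?_
    rintro i ⟨b, hb⟩
    simp only [coe_toFinset, Set.mem_ofPred_eq, List.mem_map]
    exact ⟨_, hb, rfl⟩
  have hne : {i : ℤ | ∃ b, ((y, i), b) ∈ L'}.Nonempty := by
    obtain ⟨b, hb⟩ := hyL
    obtain ⟨i, hi⟩ := exists_mem_levelRewrite hys hb 0
    exact ⟨i, b, hi⟩
  obtain ⟨m, ⟨bm, hm⟩, hmin⟩ := Set.exists_min_image _ id hfin hne
  obtain ⟨M, ⟨bM, hM⟩, hmax⟩ := Set.exists_max_image _ id hfin hne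
  have hmM : m ≤ M := hmin M ⟨bM, hM⟩
  refine ⟨m, M, ⟨bm, hm⟩, ⟨bM, hM⟩, fun i b hi => ⟨hmin i ⟨b, hi⟩, hmax i ⟨b, hi⟩⟩, ?_⟩
  obtain ⟨G, hG, T, g, ε, hg, hT, hεT, hεg⟩ :=
    IsFreeAvoiding.exists_stable_letter (levelShift y hmM) (hfree _ _ hM)
      (by simpa [levelShift] using hfree _ _ hm)
  have hshift {a : X} (ha : a ≠ y) (k : ℤ) : T ^ k * g (of (a, 0)) = g (of (a, k)) * T ^ k := by
    have step (i : ℤ) : T * g (of (a, i)) = g (of (a, i + 1)) * T := by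
      have := hT (a, i) (by simp [ha])
      simpa [levelShift, ha] using this
    induction k with
    | zero => simp
    | succ k ih =>
      rw [add_comm, zpow_add, mul_assoc, ih, ← mul_assoc, zpow_one, step, mul_assoc, add_comm 1]
    | pred k ih =>
      have h := step (-k - 1)
      rw [sub_add_cancel] at h
      rw [sub_eq_neg_add, zpow_add, zpow_neg_one, mul_assoc, ih, ← mul_assoc, ← sub_eq_neg_add,
        inv_mul_eq_iff_eq_mul.2 ((eq_mul_inv_of_mul_eq h.symm).trans (mul_assoc _ _ _)), mul_assoc]
  have hshift_y {k : ℤ} (hk : m ≤ k) (hkM : k ≤ M) :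
      T ^ (k - m) * g (of (y, m)) = g (of (y, k)) * T ^ (k - m) := by
    induction k, hk using Int.leInduction with
    | base => simp
    | succ k hk ih =>
      have h := hT (y, k) (by simp; omega)
      have h' : levelShift y hmM (y, k) = (y, k + 1) := by
        simp [levelShift, show k ≠ M by omega, hk, show k < M by omega]
      rw [h'] at h
      rw [add_sub_right_comm, add_comm, zpow_add, mul_assoc, ih (by omega), ← mul_assoc, zpow_one,
        h, mul_assoc]
  let Φ : FreeGroup X →* G := FreeGroup.lift fun a => if a = s then T ^ c s else
    if a = y then T ^ (-m) * g (of (y, m)) * T ^ (m + c y) else g (of (a, 0)) * T ^ c a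
  have hΦs : Φ (of s) = T ^ c s := by simp [Φ]
  have hΦ : ∀ a ≠ s, ∀ k : ℤ, (a = y → m ≤ k ∧ k ≤ M) →
      T ^ k * Φ (of a) = g (of (a, k)) * T ^ (k + c a) := by
    intro a ha k hk
    by_cases hay : a = y
    · subst hay
      simp only [Φ, lift_apply_of, if_neg ha, if_true]
      rw [← mul_assoc, ← mul_assoc, ← zpow_add, ← sub_eq_add_neg, hshift_y (hk rfl).1 (hk rfl).2,
        mul_assoc, ← zpow_add]
      congr 2; ring
    · simp only [Φ, lift_apply_of, if_neg ha, if_neg hay]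
      rw [← mul_assoc, hshift hay, mul_assoc, ← zpow_add]
  refine ⟨G, hG, T, g, Φ, ε, fun w => (hg w).1, hεT, hεg, fun w hw => ?_, hΦs, hΦ⟩
  have hΦL : Φ (mk L) = 1 := by
    have := zpow_mul_lift_mk Φ g T hΦs (k := 0) (L := L) fun a i b hab =>
      hΦ a (exists_mem_of_mem_levelRewrite hab).1 i fun hay => by
        subst hay
        exact ⟨hmin i ⟨b, hab⟩, hmax i ⟨b, hab⟩⟩
    rwa [h0, add_zero, zpow_zero, mul_one, one_mul,
      (hg _).2 (subset_normalClosure (Set.mem_singleton _))] at this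
  have : normalClosure {mk L} ≤ Φ.ker := normalClosure_le_normal (by simpa using hΦL)
  exact this hw

theorem IsFreeAvoiding.of_weight (hc : c s ≠ 0) (h0 : weightSum c L = 0) (hxs : x ≠ s)
    (hxL : ∃ b, (x, b) ∈ L)
    (hfree : ∀ p b, (p, b) ∈ levelRewrite s c 0 L →
      IsFreeAvoiding (normalClosure {mk (levelRewrite s c 0 L)}) p) :
    IsFreeAvoiding (normalClosure {mk L}) x := by
  obtain ⟨m, M, ⟨b, hm⟩, -, -, G, hG, T, g, Φ, ε, hg, hεT, hεg, hΦ, hs, hΦa⟩ :=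
    exists_extension_of_levelRewrite h0 hxs hxL hfree
  intro W hW hWx hWN
  have hWx' {a i b'} (h : ((a, i), b') ∈ levelRewrite s c 0 W) : a ≠ x :=
    hWx _ (exists_mem_of_mem_levelRewrite h).2
  have key := zpow_mul_lift_mk Φ g T hs (k := 0) (L := W) fun a i b hab =>
      hΦa a (exists_mem_of_mem_levelRewrite hab).1 i fun hax => absurd hax (hWx' hab)
  rw [hΦ _ hWN, zpow_zero, mul_one, zero_add] at key
  have hW0 : weightSum c W = 0 := by
    have := congrArg ε key
    rw [_root_.map_mul, hεg, map_zpow, hεT, _root_.map_one, one_mul, ← ofAdd_zsmul] at this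
    simpa using this.symm
  rw [hW0, zpow_zero, mul_one] at key
  refine eq_nil_of_levelRewrite_eq_nil hc hW ?_ hW0 (k := 0)
  exact hfree _ _ hm _ (hW.levelRewrite hc 0) (fun p hp h => hWx' (b' := p.2) (a := p.1.1)
    (i := p.1.2) (by simpa using hp) (by rw [h])) (hg _ key.symm)

theorem not_forall_level_eq (hL : IsCyclicallyReduced L) (hxL : ∃ b, (x, b) ∈ L)
    (h0 : weightSum (Pi.single x 1) L = 0) (m : ℤ) :
    ∃ a i b, ((a, i), b) ∈ levelRewrite x (Pi.single x 1) 0 L ∧ i ≠ m := by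
  by_contra! hm
  set L' := levelRewrite x (Pi.single x 1) 0 L with hL'
  let T : FreeGroup X := of x
  let g : FreeGroup (X × ℤ) →* FreeGroup X :=
    FreeGroup.lift fun p => T ^ p.2 * of p.1 * (T ^ p.2)⁻¹
  have hg (K : List ((X × ℤ) × Bool)) (hK : ∀ p ∈ K, p.1.2 = m) :
      g (mk K) = T ^ m * mk (K.map fun p => (p.1.1, p.2)) * (T ^ m)⁻¹ := by
    induction K with
    | nil => simp [← one_eq_mk]
    | cons p K ih =>
      rw [mk_cons, _root_.map_mul, ih fun q hq => hK q (by simp [hq]), List.map_cons, mk_cons,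
        ← hK p (by simp)]
      obtain ⟨p, _ | _⟩ := p <;> simp [g, mul_assoc]
  have key := zpow_mul_lift_mk (MonoidHom.id _) g T (s := x) (c := Pi.single x 1) (by simp [T])
    (k := 0) (L := L) fun a i b hab => by
      simp [g, (exists_mem_of_mem_levelRewrite hab).1]
  rw [h0, zpow_zero, one_mul, add_zero, zpow_zero, mul_one, MonoidHom.id_apply,
    hg _ fun p hp => hm p.1.1 p.1.2 p.2 hp] at key
  set V := L'.map fun p => (p.1.1, p.2)
  let ν (w : FreeGroup X) : ℕ := w.toWord.countP fun p => p.1 = x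
  have hν (u v) : ν (u * v) ≤ ν u + ν v := by
    simpa [ν] using (toWord_mul_sublist u v).countP_le (p := fun p => decide (p.1 = x))
  have hV (n : ℕ) : ν (mk V ^ n) = 0 := by
    induction n with
    | zero => simp [ν]
    | succ n ih =>
      have hV1 : ν (mk V) = 0 := by
        refine Nat.eq_zero_of_le_zero
          ((reduce.red.sublist.countP_le (p := fun p => decide (p.1 = x))).trans ?_)
        rw [Nat.le_zero, List.countP_eq_zero]
        intro p hp
        obtain ⟨q, hq, rfl⟩ := List.mem_map.1 hp
        simpa using (exists_mem_of_mem_levelRewrite (a := q.1.1) (i := q.1.2) (b := q.2) hq).1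
      have := hν (mk V ^ n) (mk V)
      rw [← pow_succ] at this
      omega
  have hpow (n : ℕ) : n * L.countP (fun p => p.1 = x) ≤ ν (T ^ m) + ν (T ^ m)⁻¹ := by
    have h₁ : ν (mk L ^ n) = n * L.countP (fun p => p.1 = x) := by
      simp only [ν, toWord_pow, toWord_mk, hL.isReduced.reduce_eq]
      rw [(hL.flatten_replicate n).isReduced.reduce_eq, List.countP_flatten]
      simp
    have h₂ := hν (T ^ m * mk V ^ n) (T ^ m)⁻¹
    have h₃ := hν (T ^ m) (mk V ^ n)
    rw [← conj_pow, ← key, h₁] at h₂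
    have := hV n
    omega
  have hpos : 0 < L.countP (fun p => p.1 = x) := by
    rw [List.countP_pos_iff]
    obtain ⟨b, hb⟩ := hxL
    exact ⟨_, hb, by simp⟩
  have := hpow (ν (T ^ m) + ν (T ^ m)⁻¹ + 1)
  nlinarith

theorem IsFreeAvoiding.of_two_letters (hL : IsCyclicallyReduced L)
    (h0 : weightSum (Pi.single x 1) L = 0) (hxL : ∃ b, (x, b) ∈ L) (hyx : y ≠ x)
    (hyL : ∃ b, (y, b) ∈ L) (hxy : ∀ p ∈ L, p.1 = x ∨ p.1 = y)
    (hfree : ∀ p b, (p, b) ∈ levelRewrite x (Pi.single x 1) 0 L →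
      IsFreeAvoiding (normalClosure {mk (levelRewrite x (Pi.single x 1) 0 L)}) p) :
    IsFreeAvoiding (normalClosure {mk L}) x := by
  obtain ⟨m, M, ⟨b, hm⟩, ⟨bM, hM⟩, hmM, G, hG, T, g, Φ, ε, hg, -, -, hΦ, hs, hΦa⟩ :=
    exists_extension_of_levelRewrite h0 hyx hyL hfree
  have hlt : m < M := by
    obtain ⟨a, i, b', hi, him⟩ := not_forall_level_eq hL hxL h0 m
    obtain ⟨ha, haL⟩ := exists_mem_of_mem_levelRewrite hi
    obtain rfl : a = y := (hxy _ haL).resolve_left ha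
    have := hmM i b' hi
    omega
  intro W hW hWx hWN
  have hlevel (K : List (X × Bool)) (hK : ∀ p ∈ K, p.1 ≠ x) :
      levelRewrite x (Pi.single x 1) m K = K.map fun p => ((p.1, m), p.2) := by
    induction K with
    | nil => simp [levelRewrite]
    | cons p K ih =>
      have hp := hK p (by simp)
      have := ih fun q hq => hK q (by simp [hq])
      obtain ⟨a, _ | _⟩ := p <;> simp_all [levelRewrite]
  have hW0 : weightSum (Pi.single x 1) W = 0 := by
    refine List.sum_eq_zero fun z hz => ?_
    obtain ⟨p, hp, rfl⟩ := List.mem_map.1 hz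
    obtain ⟨a, _ | _⟩ := p <;> simp [Pi.single_eq_of_ne (hWx _ hp)]
  have key := zpow_mul_lift_mk Φ g T hs (k := m) (L := W) fun a i b hab => by
    refine hΦa a (exists_mem_of_mem_levelRewrite hab).1 i fun _ => ?_
    rw [hlevel W hWx] at hab
    obtain ⟨p, -, hp⟩ := List.mem_map.1 hab
    simp only [Prod.mk.injEq] at hp
    omega
  rw [hΦ _ hWN, mul_one, hW0, add_zero, right_eq_mul] at key
  refine eq_nil_of_levelRewrite_eq_nil (s := x) (c := Pi.single x 1) (by simp) hW ?_ hW0 (k := m)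
  refine hfree _ _ hM _ (hW.levelRewrite (by simp) m) (fun p hp h => ?_) (hg _ key)
  rw [hlevel W hWx] at hp
  obtain ⟨q, -, rfl⟩ := List.mem_map.1 hp
  simp only [Prod.mk.injEq] at h
  omega

omit [DecidableEq X] in
theorem weightSum_add (c₁ c₂ : X → ℤ) :
    weightSum (c₁ + c₂) L = weightSum c₁ L + weightSum c₂ L := by
  induction L with
  | nil => simp [weightSum]
  | cons p L ih =>
    obtain ⟨a, _ | _⟩ := p <;> simp [weightSum_cons, ih] <;> ring

omit [DecidableEq X] in
theorem weightSum_smul (k : ℤ) (c : X → ℤ) : weightSum (k • c) L = k * weightSum c L := by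
  induction L with
  | nil => simp [weightSum]
  | cons p L ih =>
    rw [weightSum_cons, ih, weightSum_cons]
    obtain ⟨a, _ | _⟩ := p <;> simp <;> ring

/-- If every letter of the word `L` is `x`, the other generators are free modulo `L`. -/
theorem IsFreeAvoiding.of_forall_eq (hL : ∀ p ∈ L, p.1 = x) :
    IsFreeAvoiding (normalClosure {mk L}) x := by
  let f : FreeGroup X →* FreeGroup X := FreeGroup.lift fun a => if a = x then 1 else of a
  intro W hW hWx hWN
  have hf : normalClosure {mk L} ≤ f.ker := by
    refine normalClosure_le_normal ?_
    rw [Set.singleton_subset_iff, SetLike.mem_coe, MonoidHom.mem_ker, lift_mk]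
    refine List.prod_eq_one fun z hz => ?_
    obtain ⟨⟨a, b⟩, hp, rfl⟩ := List.mem_map.1 hz
    cases b <;> simp [show a = x from hL _ hp]
  have hfW : f (mk W) = mk W := by
    clear hW hWN
    induction W with
    | nil => simp [← one_eq_mk]
    | cons p W ih =>
      have hp := hWx p (by simp)
      rw [mk_cons, _root_.map_mul, ih fun q hq => hWx q (by simp [hq])]
      obtain ⟨a, _ | _⟩ := p <;> simp_all [f]
  have h1 : mk W = 1 := hfW.symm.trans (hf hWN)
  rw [← hW.reduce_eq, ← toWord_mk, h1, toWord_one]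

/-- **Magnus' Freiheitssatz**: in a one-relator group with cyclically reduced relator, the
generators other than one occurring in the relator are free. -/
theorem freiheitssatz {X : Type u} {L : List (X × Bool)} (hL : IsCyclicallyReduced L) {x : X}
    (hx : ∃ b, (x, b) ∈ L) : IsFreeAvoiding (normalClosure {mk L}) x := by
  classical
  induction hn : L.length using Nat.strong_induction_on generalizing X with
  | _ n ih =>
    subst hn
    have hrec {s : X} {c : X → ℤ} (hc : c s ≠ 0) (hs : ∃ b, (s, b) ∈ L)
        (h0 : weightSum c L = 0) (p : X × ℤ) (b : Bool) (hp : (p, b) ∈ levelRewrite s c 0 L) :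
        IsFreeAvoiding (normalClosure {mk (levelRewrite s c 0 L)}) p :=
      ih _ (length_levelRewrite_lt hs 0) (hL.levelRewrite hc h0 0) ⟨b, hp⟩ rfl
    by_cases hall : ∀ p ∈ L, p.1 = x
    · exact .of_forall_eq hall
    push Not at hall
    obtain ⟨⟨t, bt⟩, ht, htx⟩ := hall
    let σ (a : X) : ℤ := weightSum (Pi.single a 1) L
    have hpair {a s : X} (hs : s ≠ x) (hsL : ∃ b, (s, b) ∈ L) (has : a ≠ s) (ha : σ a ≠ 0) :
        IsFreeAvoiding (normalClosure {mk L}) x := by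
      let c : X → ℤ := σ a • Pi.single s 1 + (-σ s) • Pi.single a 1
      have hc : c s ≠ 0 := by simpa [c, Pi.single_eq_of_ne has.symm] using ha
      have h0 : weightSum c L = 0 := by
        rw [weightSum_add, weightSum_smul, weightSum_smul]
        simp only [σ]; ring
      exact .of_weight hc h0 hs.symm hx (hrec hc hsL h0)
    have hzero {s : X} (hs : s ≠ x) (hsL : ∃ b, (s, b) ∈ L) (h0 : σ s = 0) :
        IsFreeAvoiding (normalClosure {mk L}) x :=
      .of_weight (by simp) h0 hs.symm hx (hrec (by simp) hsL h0)
    by_cases hσx : σ x = 0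
    swap
    · exact hpair htx ⟨_, ht⟩ htx.symm hσx
    by_cases htwo : ∀ p ∈ L, p.1 = x ∨ p.1 = t
    · exact .of_two_letters hL hσx hx htx ⟨_, ht⟩ htwo (hrec (by simp) hx hσx)
    push Not at htwo
    obtain ⟨⟨y, b⟩, hy, hyx, hyt⟩ := htwo
    by_cases hσt : σ t = 0
    · exact hzero htx ⟨_, ht⟩ hσt
    · exact hpair hyx ⟨_, hy⟩ (Ne.symm hyt) hσt

end Freiheitssatz

end FreeGroup

section WeightedShifts

theorem lp.summable_norm_sq {ι : Type*} (f : lp (fun _ : ι => ℂ) 2) :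
    Summable fun i => ‖f i‖ ^ 2 := by
  simpa using (lp.memℓp f).summable (by norm_num)

theorem lp.norm_sq_eq_tsum {ι : Type*} (f : lp (fun _ : ι => ℂ) 2) :
    ‖f‖ ^ 2 = ∑' i, ‖f i‖ ^ 2 := by
  simpa using lp.norm_rpow_eq_tsum (p := 2) (by norm_num) f

/-- A weighted Schur test for sums of right translations indexed by a symmetric family. -/
theorem norm_sum_translations_le {G ι : Type*} [Group G] [Fintype ι] {g : ι → G}
    {σ : Equiv.Perm ι} {w : G → ι → ℝ} (hw0 : ∀ x i, 0 < w x i)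
    (hw : ∀ x i, w x i * w (x * g i) (σ i) = 1) {Λ : ℝ} (hΛ0 : 0 ≤ Λ)
    (hΛ : ∀ x, ∑ i, w x i ≤ Λ) {k : ℂ}
    {A : lp (fun _ : G => ℂ) 2 →L[ℂ] lp (fun _ : G => ℂ) 2}
    (hA : ∀ (f : lp (fun _ : G => ℂ) 2) x, A f x = k * ∑ i, f (x * g i)) :
    ‖A‖ ≤ ‖k‖ * Λ := by
  refine A.opNorm_le_bound (by positivity) fun f => ?_
  have hf := lp.summable_norm_sq f
  have hwΛ (x : G) (i : ι) : w x i ≤ Λ :=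
    (Finset.single_le_sum (fun j _ => (hw0 x j).le) (Finset.mem_univ i)).trans (hΛ x)
  have hsum (i : ι) : Summable fun x => ‖f x‖ ^ 2 * w x i :=
    (hf.mul_right Λ).of_nonneg_of_le (fun x => mul_nonneg (sq_nonneg _) (hw0 x i).le)
      fun x => mul_le_mul_of_nonneg_left (hwΛ x i) (sq_nonneg _)
  have hpt (x : G) : ‖∑ i, f (x * g i)‖ ^ 2 ≤
      Λ * ∑ i, ‖f (x * g i)‖ ^ 2 * w (x * g i) (σ i) := by
    have hcs : (∑ i, ‖f (x * g i)‖) ^ 2 ≤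
        (∑ i, w x i) * ∑ i, ‖f (x * g i)‖ ^ 2 * w (x * g i) (σ i) := by
      refine Finset.sum_sq_le_sum_mul_sum_of_sq_le_mul _ (fun i _ => (hw0 x i).le)
        (fun i _ => mul_nonneg (sq_nonneg _) (hw0 _ _).le) fun i _ => le_of_eq ?_
      linear_combination -‖f (x * g i)‖ ^ 2 * hw x i
    calc ‖∑ i, f (x * g i)‖ ^ 2 ≤ (∑ i, ‖f (x * g i)‖) ^ 2 := by
          gcongr; exact norm_sum_le _ _
      _ ≤ _ := hcs
      _ ≤ _ := by
        gcongr
        · exact Finset.sum_nonneg fun i _ => mul_nonneg (sq_nonneg _) (hw0 _ _).le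
        · exact hΛ x
  have htotal : ∑ i, ∑' x, ‖f x‖ ^ 2 * w x (σ i) ≤ Λ * ‖f‖ ^ 2 := by
    rw [Equiv.sum_comp σ fun i => ∑' x, ‖f x‖ ^ 2 * w x i,
      ← Summable.tsum_finsetSum fun i _ => hsum i, lp.norm_sq_eq_tsum, ← tsum_mul_left]
    refine Summable.tsum_le_tsum (fun x => ?_) (summable_sum fun i _ => hsum i) (hf.mul_left Λ)
    rw [← Finset.mul_sum, mul_comm]
    gcongr
    exact hΛ x
  refine lp.norm_le_of_forall_sum_le (by norm_num) (by positivity) fun T => ?_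
  simp only [ENNReal.toReal_ofNat, Real.rpow_ofNat]
  calc ∑ x ∈ T, ‖A f x‖ ^ 2 ≤
      ∑ x ∈ T, ‖k‖ ^ 2 * (Λ * ∑ i, ‖f (x * g i)‖ ^ 2 * w (x * g i) (σ i)) := by
        gcongr with x
        rw [hA, norm_mul, mul_pow]
        gcongr
        exact hpt x
    _ = ‖k‖ ^ 2 * Λ * ∑ i, ∑ x ∈ T, ‖f (x * g i)‖ ^ 2 * w (x * g i) (σ i) := by
        rw [Finset.sum_comm, ← Finset.mul_sum, ← Finset.mul_sum, mul_assoc]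
    _ ≤ ‖k‖ ^ 2 * Λ * ∑ i, ∑' x, ‖f x‖ ^ 2 * w x (σ i) := by
        gcongr with i
        have hinj : Function.Injective fun x : G => x * g i := mul_left_injective _
        have := (hsum (σ i)).sum_le_tsum (T.map ⟨_, hinj⟩)
          fun x _ => mul_nonneg (sq_nonneg _) (hw0 x _).le
        simpa using this
    _ ≤ ‖k‖ ^ 2 * Λ * (Λ * ‖f‖ ^ 2) := by gcongr
    _ = (‖k‖ * Λ * ‖f‖) ^ 2 := by ring

end WeightedShifts

namespace FreeGroup

section UpperBound

universe u v

theorem mk_letter_mul_inverse {X : Type u} (p : X × Bool) :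
    (mk [p] : FreeGroup X) * mk [(p.1, !p.2)] = 1 := by
  rw [mul_mk, one_eq_mk]
  exact Quot.sound (by simpa using Red.Step.not (L₁ := []) (L₂ := []) (x := p.1) (b := p.2))

theorem norm_mul_letter {X : Type u} [DecidableEq X] (u : FreeGroup X) (p : X × Bool) :
    (u * mk [p]).norm = u.norm + 1 ∨
      ((u * mk [p]).norm + 1 = u.norm ∧ u.toWord.getLast? = some (p.1, !p.2)) := by
  by_cases h : IsReduced (u.toWord ++ [p])
  · left
    have : (u * mk [p]).toWord = u.toWord ++ [p] := by
      rw [toWord_mul, toWord_mk, reduce_singleton, h.reduce_eq]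
    simp [norm, this]
  · right
    rw [IsReduced, List.isChain_append] at h
    have hlast : u.toWord.getLast? = some (p.1, !p.2) := by
      by_contra hne
      refine h ⟨isReduced_toWord, List.isChain_singleton p, fun q hq q' hq' heq => ?_⟩
      obtain rfl : p = q' := by simpa using hq'
      by_contra hb
      refine hne (hq.trans ?_)
      obtain ⟨a, b⟩ := q
      obtain rfl : a = p.1 := heq
      obtain rfl : b = !p.2 := Bool.eq_not_of_ne hb
      rfl
    refine ⟨?_, hlast⟩
    obtain ⟨W, hW⟩ := List.getLast?_eq_some_iff.1 hlast
    have hWr : IsReduced W := isReduced_toWord.infix (L₂ := u.toWord) ⟨[], _, hW.symm⟩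
    have hu : u * mk [p] = mk W := by
      rw [← mk_toWord (x := u), hW, ← mul_mk, mul_assoc]
      have := mk_letter_mul_inverse (p.1, !p.2)
      rw [Bool.not_not] at this
      rw [this, mul_one]
    rw [hu, norm, norm, toWord_mk, hWr.reduce_eq, hW, List.length_append, List.length_singleton]

theorem sum_zpow_norm_mul_letter_le {X : Type u} [DecidableEq X] [Fintype X] [Nonempty X]
    (u : FreeGroup X) {q : ℝ} (hq : q = 2 * Fintype.card X - 1) :
    ∑ p : X × Bool, (√q)⁻¹ ^ (((u * mk [p]).norm : ℤ) - u.norm) ≤ 2 * √q := by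
  have hcard : (Fintype.card (X × Bool) : ℝ) = q + 1 := by
    simp [hq]; ring
  have hq1 : 1 ≤ q := by
    have : (1 : ℝ) ≤ Fintype.card X := by exact_mod_cast Fintype.card_pos
    linarith
  have hs : 1 ≤ √q := Real.one_le_sqrt.2 hq1
  have hsq : √q * √q = q := Real.mul_self_sqrt (by linarith)
  have hup {p : X × Bool} (h : (u * mk [p]).norm = u.norm + 1) :
      (√q)⁻¹ ^ (((u * mk [p]).norm : ℤ) - u.norm) = (√q)⁻¹ := by simp [h]
  have hqs : q * (√q)⁻¹ = √q := by
    rw [mul_inv_eq_iff_eq_mul₀ (by positivity), hsq]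
  by_cases hall : ∀ p : X × Bool, (u * mk [p]).norm = u.norm + 1
  · rw [Finset.sum_congr rfl fun p _ => hup (hall p)]
    rw [Finset.sum_const, nsmul_eq_mul, Finset.card_univ, hcard]
    have : (√q)⁻¹ ≤ 1 := inv_le_one_of_one_le₀ hs
    linarith
  · push Not at hall
    obtain ⟨p₀, hp₀⟩ := hall
    obtain ⟨hdown, hlast⟩ := (norm_mul_letter u p₀).resolve_left hp₀
    have hrest {p : X × Bool} (hp : p ≠ p₀) : (u * mk [p]).norm = u.norm + 1 := by
      refine (norm_mul_letter u p).resolve_right fun h => hp ?_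
      have := h.2.symm.trans hlast
      simp only [Option.some.injEq, Prod.mk.injEq, Bool.not_inj_iff] at this
      exact Prod.ext this.1 this.2
    rw [← Finset.add_sum_erase _ _ (Finset.mem_univ p₀),
      Finset.sum_congr rfl fun p hp => hup (hrest (Finset.ne_of_mem_erase hp))]
    have h₀ : (√q)⁻¹ ^ (((u * mk [p₀]).norm : ℤ) - u.norm) = √q := by
      rw [← hdown]; simp
    rw [h₀, Finset.sum_const, nsmul_eq_mul, Finset.card_erase_of_mem (Finset.mem_univ _),
      Finset.card_univ, Nat.cast_sub Fintype.card_pos, hcard]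
    push_cast
    linarith

/-- If all generators but `x` generate a free subgroup, the averaging operator over the generators
has norm at most `(√(2h - 3) + 1) / h`. -/
theorem norm_average_le {α : Type u} [Fintype α] {G : Type v} [Group G] {π : FreeGroup α →* G}
    {x : α} (hπ : Function.Injective (π.comp (map (Subtype.val : {a // a ≠ x} → α))))
    {h : ℕ} (hh : 2 ≤ h) (hcard : Fintype.card α = h)
    {M : lp (fun _ : G => ℂ) 2 →L[ℂ] lp (fun _ : G => ℂ) 2}
    (hM : ∀ (f : lp (fun _ : G => ℂ) 2) g,
      M f g = (2 * (h : ℂ))⁻¹ * ∑ p : α × Bool, f (g * π (mk [p]))) :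
    ‖M‖ ≤ (√(2 * h - 3) + 1) / h := by
  classical
  set ψ := π.comp (map (Subtype.val : {a // a ≠ x} → α)) with hψ
  have hrep (g : G) : ∃ u, g = (QuotientGroup.mk g : G ⧸ ψ.range).out * ψ u := by
    obtain ⟨⟨_, u, rfl⟩, hu⟩ := QuotientGroup.mk_out_eq_mul ψ.range g
    exact ⟨u⁻¹, by rw [hu]; simp⟩
  choose u hu using hrep
  have hstep (g : G) (v : FreeGroup {a // a ≠ x}) : u (g * ψ v) = u g * v := by
    have hcoset : (QuotientGroup.mk (g * ψ v) : G ⧸ ψ.range) = QuotientGroup.mk g :=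
      QuotientGroup.mk_mul_of_mem g ⟨v, rfl⟩
    have h1 := hu (g * ψ v)
    rw [hcoset] at h1
    refine hπ ?_
    rw [_root_.map_mul]
    refine mul_left_cancel (a := (QuotientGroup.mk g : G ⧸ ψ.range).out) ?_
    rw [← h1, ← mul_assoc, ← hu g]
  have hletter {p : α × Bool} (hp : p.1 ≠ x) : π (mk [p]) = ψ (mk [(⟨p.1, hp⟩, p.2)]) := by
    simp [hψ]
  have hcard' : (Fintype.card {a // a ≠ x} : ℝ) = h - 1 := by
    have : Fintype.card {a // a ≠ x} = h - 1 := by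
      simp [Fintype.card_subtype_compl, hcard]
    rw [this, Nat.cast_sub (by omega), Nat.cast_one]
  have hq1 : (1 : ℝ) ≤ 2 * h - 3 := by
    have : (2 : ℝ) ≤ h := by exact_mod_cast hh
    linarith
  have : Nonempty {a // a ≠ x} := by
    rw [← Fintype.card_pos_iff, ← Nat.cast_pos (α := ℝ), hcard']; linarith
  set q : ℝ := 2 * h - 3 with hq
  have hsqrt : 0 < √q := Real.sqrt_pos.2 (by linarith)
  let w (g : G) (p : α × Bool) : ℝ :=
    if p.1 = x then 1 else (√q)⁻¹ ^ (((u (g * π (mk [p]))).norm : ℤ) - (u g).norm)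
  have hinv (p : α × Bool) : π (mk [p]) * π (mk [(p.1, !p.2)]) = 1 := by
    rw [← _root_.map_mul, mk_letter_mul_inverse, _root_.map_one]
  have hbound : ‖M‖ ≤ ‖(2 * (h : ℂ))⁻¹‖ * (2 + 2 * √q) := by
    refine norm_sum_translations_le (g := fun p : α × Bool => π (mk [p]))
      (σ := (Equiv.refl α).prodCongr Equiv.boolNot) (w := w) (fun g p => ?_) (fun g p => ?_)
      (by positivity) (fun g => ?_) hM
    · simp only [w]; split_ifs <;> positivity
    · change w g p * w (g * π (mk [p])) (p.1, !p.2) = 1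
      by_cases hp : p.1 = x
      · simp [w, hp]
      · simp only [w, if_neg hp]
        rw [mul_assoc, hinv, mul_one, ← zpow_add₀ (by positivity)]
        simp
    · rw [← Finset.sum_filter_add_sum_filter_not _ (fun p : α × Bool => p.1 = x)]
      gcongr
      · rw [Finset.sum_congr rfl fun p hp => if_pos (Finset.mem_filter.1 hp).2, Finset.sum_const,
          show Finset.univ.filter (fun p : α × Bool => p.1 = x) = {x} ×ˢ Finset.univ by
            ext; simp only [Finset.mem_filter, Finset.mem_product, Finset.mem_univ,
              Finset.mem_singleton, true_and, and_true]]
        simp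
      · refine le_of_eq_of_le ?_ (sum_zpow_norm_mul_letter_le (u g) (q := q) (by
          rw [hcard', hq]; ring))
        symm
        refine Finset.sum_bij (fun p _ => (p.1.1, p.2)) (fun p _ => by simpa using p.1.2)
          (fun p _ p' _ heq => ?_) (fun p hp => ?_) (fun p _ => ?_)
        · simpa [Prod.ext_iff, Subtype.ext_iff] using heq
        · exact ⟨(⟨p.1, (Finset.mem_filter.1 hp).2⟩, p.2), by simp, rfl⟩
        · simp only [w, if_neg p.1.2]
          rw [hletter p.1.2, hstep]
  refine hbound.trans (le_of_eq ?_)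
  have h0 : (h : ℝ) ≠ 0 := by positivity
  simp only [norm_inv, norm_mul, Complex.norm_ofNat, Complex.norm_natCast]
  field_simp
  ring

end UpperBound

end FreeGroup

/-- A sequence contracted by a factor `ρ < 1` after every `K` steps is summable against quadratic
weights. -/
theorem summable_one_add_mul_sq_mul {u : ℕ → ℝ} (hu : ∀ n, 0 ≤ u n) {K : ℕ} (hK : K ≠ 0) {ρ : ℝ}
    (hρ0 : 0 < ρ) (hρ1 : ρ < 1) (h : ∀ n, 1 ≤ n → u (n + K) ≤ ρ * u n) (c : ℝ) :
    Summable fun n : ℕ => (1 + n * c) ^ 2 * u n := by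
  set σ : ℝ := ρ ^ (K : ℝ)⁻¹ with hσ
  have hσK : σ ^ K = ρ := Real.rpow_inv_natCast_pow hρ0.le hK
  have hσ0 : 0 < σ := Real.rpow_pos_of_pos hρ0 _
  have hσ1 : σ < 1 := Real.rpow_lt_one hρ0.le hρ1 (by positivity)
  set B := ∑ i ∈ Finset.range (K + 1), u i with hB
  have hB0 : 0 ≤ B := Finset.sum_nonneg fun i _ => hu i
  have hbound (n : ℕ) : u n ≤ B / ρ * σ ^ n := by
    induction n using Nat.strong_induction_on with
    | _ n ih =>
      by_cases hn : n ≤ K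
      · have h1 : u n ≤ B :=
          Finset.single_le_sum (fun i _ => hu i) (Finset.mem_range.2 (by omega))
        have h2 : ρ ≤ σ ^ n := hσK ▸ pow_le_pow_of_le_one hσ0.le hσ1.le hn
        rw [div_mul_eq_mul_div, le_div_iff₀ hρ0]
        gcongr
      · obtain ⟨m, rfl⟩ := Nat.exists_eq_add_of_le' (not_le.1 hn).le
        calc u (m + K) ≤ ρ * u m := h m (by omega)
          _ ≤ ρ * (B / ρ * σ ^ m) := by gcongr; exact ih m (by omega)
          _ = B / ρ * σ ^ (m + K) := by rw [pow_add, hσK]; ring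
  have hgeom (k : ℕ) : Summable fun n : ℕ => (n : ℝ) ^ k * σ ^ n :=
    summable_pow_mul_geometric_of_norm_lt_one k (by rwa [Real.norm_of_nonneg hσ0.le])
  have hmaj : Summable fun n : ℕ => (1 + n * c) ^ 2 * (B / ρ * σ ^ n) := by
    refine (((hgeom 0).mul_left (B / ρ)).add (((hgeom 1).mul_left (2 * c * (B / ρ))).add
      ((hgeom 2).mul_left (c ^ 2 * (B / ρ))))).congr fun n => ?_
    ring
  exact hmaj.of_nonneg_of_le (fun n => mul_nonneg (sq_nonneg _) (hu n))
    fun n => mul_le_mul_of_nonneg_left (hbound n) (sq_nonneg _)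

namespace FreeGroup

section Counting

universe u

open List

theorem isReduced_append_cons_iff {α : Type u} {D E : List (α × Bool)} {a b : α × Bool} :
    IsReduced (D ++ a :: b :: E) ↔
      IsReduced (D ++ [a]) ∧ b ≠ (a.1, !a.2) ∧ IsReduced (b :: E) := by
  have hab : (a.1 = b.1 → a.2 = b.2) ↔ b ≠ (a.1, !a.2) := by
    obtain ⟨a, x⟩ := a
    obtain ⟨b, y⟩ := b
    cases x <;> cases y <;> simp [eq_comm]
  rw [IsReduced, IsReduced, IsReduced, ← hab, List.isChain_append_cons_cons]

variable {α : Type u} [Fintype α]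

/-- The words of length `n`. -/
def wordsOfLength (α : Type u) [Fintype α] (n : ℕ) : Finset (List (α × Bool)) :=
  (List.finite_length_eq (α × Bool) n).toFinset

theorem mem_wordsOfLength {n : ℕ} {L : List (α × Bool)} :
    L ∈ wordsOfLength α n ↔ L.length = n := by
  simp [wordsOfLength]

open Classical in
/-- The reduced words of length `n` without a factor `R`. -/
def reducedAvoiding (R : List (α × Bool)) (n : ℕ) : Finset (List (α × Bool)) :=
  (wordsOfLength α n).filter fun L => IsReduced L ∧ ¬ R <:+: L

theorem mem_reducedAvoiding {R : List (α × Bool)} {n : ℕ} {L : List (α × Bool)} :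
    L ∈ reducedAvoiding R n ↔ L.length = n ∧ IsReduced L ∧ ¬ R <:+: L := by
  simp [reducedAvoiding, mem_wordsOfLength]

open Classical in
theorem card_reduced_extensions_le {q : ℕ} (hq : Fintype.card (α × Bool) = q + 1) (k : ℕ)
    (D : List (α × Bool)) (a : α × Bool) :
    ((wordsOfLength α k).filter fun E => IsReduced (D ++ a :: E)).card ≤ q ^ k := by
  induction k generalizing D a with
  | zero =>
    rw [pow_zero, Finset.card_le_one]
    intro E hE E' hE'
    simp only [Finset.mem_filter, mem_wordsOfLength, List.length_eq_zero_iff] at hE hE'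
    rw [hE.1, hE'.1]
  | succ k ih =>
    have hsub : ((wordsOfLength α (k + 1)).filter fun E => IsReduced (D ++ a :: E)) ⊆
        (Finset.univ.erase (a.1, !a.2)).biUnion fun b =>
          ((wordsOfLength α k).filter fun E => IsReduced ((D ++ [a]) ++ b :: E)).image
            (b :: ·) := by
      intro E hE
      rw [Finset.mem_filter, mem_wordsOfLength] at hE
      obtain ⟨hlen, hE⟩ := hE
      obtain ⟨b, E, rfl⟩ := List.exists_cons_of_length_eq_add_one hlen
      rw [Finset.mem_biUnion]
      refine ⟨b, Finset.mem_erase.2 ⟨(isReduced_append_cons_iff.1 hE).2.1, Finset.mem_univ _⟩,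
        Finset.mem_image_of_mem _ (Finset.mem_filter.2 ⟨mem_wordsOfLength.2 ?_, ?_⟩)⟩
      · simpa using hlen
      · simpa using hE
    refine (Finset.card_le_card hsub).trans ((Finset.card_biUnion_le_card_mul _ _ (q ^ k)
      fun b _ => Finset.card_image_le.trans (ih _ b)).trans ?_)
    rw [Finset.card_erase_of_mem (Finset.mem_univ _), Finset.card_univ, hq, pow_succ']
    simp

open Classical in
theorem card_reducedAvoiding_add_le {q : ℕ} (hq : Fintype.card (α × Bool) = q + 1) (hq2 : 2 ≤ q)
    {R : List (α × Bool)} (hR : IsReduced R) {n : ℕ} (hn : 1 ≤ n) :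
    (reducedAvoiding R (n + (R.length + 1))).card ≤
      (q ^ (R.length + 1) - 1) * (reducedAvoiding R n).card := by
  refine Finset.card_le_mul_card_image_of_maps_to (f := List.take n) (fun L hL => ?_) _
    fun D hD => ?_
  · rw [mem_reducedAvoiding] at hL ⊢
    refine ⟨by simp [hL.1], hL.2.1.infix (List.take_prefix n L).isInfix,
      fun h => hL.2.2 (h.trans (List.take_prefix n L).isInfix)⟩
  · obtain ⟨hlen, hDr, -⟩ := mem_reducedAvoiding.1 hD
    obtain ⟨D, a, rfl⟩ := D.eq_nil_or_concat.resolve_left (by rintro rfl; simp at hlen; omega)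
    rw [List.concat_eq_append] at *
    obtain ⟨b, hba, hbR⟩ : ∃ b : α × Bool, b ≠ (a.1, !a.2) ∧ IsReduced (b :: R) := by
      cases R with
      | nil =>
        obtain ⟨b, hb⟩ := Finset.exists_mem_notMem_of_card_lt_card
          (s := {(a.1, !a.2)}) (t := Finset.univ) (by rw [Finset.card_univ, hq]; simp; omega)
        exact ⟨b, by simpa using hb, .singleton⟩
      | cons d R =>
        obtain ⟨b, hb⟩ := Finset.exists_mem_notMem_of_card_lt_card
          (s := {(a.1, !a.2), (d.1, !d.2)}) (t := Finset.univ) (by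
            rw [Finset.card_univ, hq]
            exact Finset.card_le_two.trans_lt (by omega))
        simp only [Finset.mem_univ, Finset.mem_insert, Finset.mem_singleton, not_or,
          true_and] at hb
        refine ⟨b, hb.1, (isReduced_append_cons_iff (D := [])).2 ⟨.singleton, ?_, hR⟩⟩
        rintro rfl
        simp at hb
    have hmem : b :: R ∈
        (wordsOfLength α (R.length + 1)).filter fun E => IsReduced (D ++ a :: E) := by
      rw [Finset.mem_filter, mem_wordsOfLength, isReduced_append_cons_iff]
      exact ⟨rfl, hDr, hba, hbR⟩
    have hcard := card_reduced_extensions_le hq (R.length + 1) D a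
    calc _ ≤ (((wordsOfLength α (R.length + 1)).filter
          fun E => IsReduced (D ++ a :: E)).erase (b :: R)).card := by
          refine Finset.card_le_card_of_injOn (List.drop n) (fun L hL => ?_)
            fun L hL L' hL' heq => ?_
          · simp only [Finset.coe_filter, mem_reducedAvoiding, Set.mem_ofPred_eq] at hL
            have hLD : L = D ++ a :: L.drop n := by
              conv_lhs => rw [← List.take_append_drop n L, hL.2]
              simp
            rw [Finset.mem_coe, Finset.mem_erase, Finset.mem_filter, mem_wordsOfLength, ← hLD]
            refine ⟨fun h => hL.1.2.2 ?_, by simp [hL.1.1], hL.1.2.1⟩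
            rw [hLD, h]
            exact ⟨D ++ [a, b], [], by simp⟩
          · simp only [Finset.coe_filter, Set.mem_ofPred_eq] at hL hL'
            rw [← List.take_append_drop n L, ← List.take_append_drop n L', hL.2, hL'.2, heq]
      _ ≤ _ := by
        rw [Finset.card_erase_of_mem hmem]
        exact Nat.sub_le_sub_right hcard 1

/-- Against quadratic weights, the reduced words avoiding `R` of length `n` are summably few
compared with `q ^ n`. -/
theorem summable_card_reducedAvoiding {q : ℕ} (hq : Fintype.card (α × Bool) = q + 1)
    (hq2 : 2 ≤ q) {R : List (α × Bool)} (hR : IsReduced R) (c : ℝ) :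
    Summable fun n : ℕ => (1 + n * c) ^ 2 * ((reducedAvoiding R n).card * ((q : ℝ) ^ n)⁻¹) := by
  have hq0 : (0 : ℝ) < q := by positivity
  have hqK : (1 : ℝ) < (q : ℝ) ^ (R.length + 1) :=
    one_lt_pow₀ (by exact_mod_cast (by omega : 1 < q)) (by omega)
  refine summable_one_add_mul_sq_mul (fun n => by positivity) (K := R.length + 1) (by omega)
    (ρ := 1 - ((q : ℝ) ^ (R.length + 1))⁻¹) (by simpa using inv_lt_one_of_one_lt₀ hqK)
    (by simp only [sub_lt_self_iff]; positivity) (fun n hn => ?_) c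
  have h : ((reducedAvoiding R (n + (R.length + 1))).card : ℝ) ≤
      ((q : ℝ) ^ (R.length + 1) - 1) * (reducedAvoiding R n).card := by
    have := card_reducedAvoiding_add_le hq hq2 hR hn
    rw [← Nat.cast_le (α := ℝ), Nat.cast_mul, Nat.cast_sub (Nat.one_le_pow _ _ (by omega))] at this
    simpa using this
  calc _ ≤ ((q : ℝ) ^ (R.length + 1) - 1) * (reducedAvoiding R n).card *
        ((q : ℝ) ^ (n + (R.length + 1)))⁻¹ := by gcongr
    _ = _ := by
      rw [pow_add (q : ℝ) n]
      field_simp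

end Counting

end FreeGroup

theorem norm_apply_eq_of_opNorm_le {ι : Type*}
    {A : lp (fun _ : ι => ℂ) 2 →L[ℂ] lp (fun _ : ι => ℂ) 2}
    {a : ℝ} (hA : ‖A‖ ≤ a) {f : lp (fun _ : ι => ℂ) 2} (hf : ∀ x, a * ‖f x‖ ≤ ‖A f x‖) (x : ι) :
    ‖A f x‖ = a * ‖f x‖ := by
  have ha : 0 ≤ a := (norm_nonneg _).trans hA
  refine ((hf x).eq_of_not_lt fun hlt => ?_).symm
  have hsum := (lp.summable_norm_sq f).mul_left (a ^ 2)
  have h1 : ∑' y, a ^ 2 * ‖f y‖ ^ 2 < ∑' y, ‖A f y‖ ^ 2 := by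
    refine Summable.tsum_lt_tsum (fun y => ?_) (i := x) ?_ hsum (lp.summable_norm_sq _)
    · rw [← mul_pow]; gcongr; exact hf y
    · rw [← mul_pow]; gcongr
  rw [tsum_mul_left, ← lp.norm_sq_eq_tsum, ← lp.norm_sq_eq_tsum, ← mul_pow] at h1
  exact (lt_of_pow_lt_pow_left₀ 2 (norm_nonneg _) h1).not_ge (A.le_of_opNorm_le hA f)

namespace FreeGroup

section QuotientNorm

universe u v

variable {α : Type u} [DecidableEq α] {G : Type v} [Group G] {π : FreeGroup α →* G}

/-- The word length in `G` with respect to the images of the generators. -/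
def quotientNorm (π : FreeGroup α →* G) (g : G) : ℕ :=
  sInf (norm '' (π ⁻¹' {g}))

theorem quotientNorm_apply_le (u : FreeGroup α) : quotientNorm π (π u) ≤ u.norm :=
  Nat.sInf_le ⟨u, rfl, rfl⟩

theorem exists_norm_eq_quotientNorm (hπ : Function.Surjective π) (g : G) :
    ∃ u, π u = g ∧ u.norm = quotientNorm π g := by
  obtain ⟨v, hv⟩ := hπ g
  exact Nat.sInf_mem (s := norm '' (π ⁻¹' {g})) ⟨_, v, hv, rfl⟩

theorem quotientNorm_one : quotientNorm π 1 = 0 := by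
  simpa using quotientNorm_apply_le (π := π) 1

theorem quotientNorm_mul_letter_le (hπ : Function.Surjective π) (g : G) (p : α × Bool) :
    quotientNorm π (g * π (mk [p])) ≤ quotientNorm π g + 1 := by
  obtain ⟨u, rfl, hu⟩ := exists_norm_eq_quotientNorm hπ g
  rw [← hu, ← _root_.map_mul]
  exact (quotientNorm_apply_le _).trans
    ((norm_mul_le _ _).trans (Nat.add_le_add_left (norm_mk_le (L₁ := [p])) _))

theorem exists_quotientNorm_mul_letter_lt (hπ : Function.Surjective π) {g : G} (hg : g ≠ 1) :
    ∃ p : α × Bool, quotientNorm π (g * π (mk [p])) + 1 ≤ quotientNorm π g := by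
  obtain ⟨u, rfl, hu⟩ := exists_norm_eq_quotientNorm hπ g
  obtain h | ⟨W, p, hW⟩ := u.toWord.eq_nil_or_concat
  · rw [toWord_eq_nil_iff] at h
    exact absurd (by rw [h, _root_.map_one]) hg
  · refine ⟨(p.1, !p.2), ?_⟩
    rw [List.concat_eq_append] at hW
    have hu' : u * mk [(p.1, !p.2)] = mk W := by
      rw [← mk_toWord (x := u), hW, ← mul_mk, mul_assoc, mk_letter_mul_inverse, mul_one]
    have hlen : u.norm = W.length + 1 := by rw [norm, hW]; simp
    rw [← _root_.map_mul, hu', ← hu, hlen]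
    gcongr
    exact (quotientNorm_apply_le _).trans norm_mk_le

theorem not_isInfix_toWord_of_norm_eq_quotientNorm {R : List (α × Bool)} (hR0 : R ≠ [])
    (hR : π (mk R) = 1) {u : FreeGroup α} (hu : u.norm = quotientNorm π (π u)) :
    ¬ R <:+: u.toWord := by
  rintro ⟨A, B, hAB⟩
  have h1 : π u = π (mk (A ++ B)) := by
    rw [← mk_toWord (x := u), ← hAB, ← mul_mk, ← mul_mk, ← mul_mk, _root_.map_mul,
      _root_.map_mul, _root_.map_mul, hR, mul_one]
  have h2 : u.norm ≤ (A ++ B).length :=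
    hu.le.trans (h1 ▸ (quotientNorm_apply_le _).trans norm_mk_le)
  have h3 : 0 < R.length := List.length_pos_iff.2 hR0
  rw [norm, ← hAB] at h2
  simp only [List.length_append] at h2
  omega

theorem card_filter_quotientNorm_eq_le [Fintype α] (hπ : Function.Surjective π)
    {R : List (α × Bool)} (hR0 : R ≠ []) (hR : π (mk R) = 1) (T : Finset G) (n : ℕ) :
    (T.filter fun g => quotientNorm π g = n).card ≤ (reducedAvoiding R n).card := by
  choose u hu hnorm using exists_norm_eq_quotientNorm hπ
  refine Finset.card_le_card_of_injOn (fun g => (u g).toWord) (fun g hg => ?_)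
    fun g _ g' _ heq => ?_
  · rw [Finset.mem_coe, mem_reducedAvoiding]
    refine ⟨(hnorm g).trans (Finset.mem_filter.1 hg).2, isReduced_toWord, ?_⟩
    exact not_isInfix_toWord_of_norm_eq_quotientNorm hR0 hR (by rw [hu, hnorm])
  · rw [← hu g, ← hu g', toWord_injective heq]

theorem summable_comp_quotientNorm [Fintype α] (hπ : Function.Surjective π)
    {R : List (α × Bool)} (hR0 : R ≠ []) (hR : π (mk R) = 1) {F : ℕ → ℝ} (hF : ∀ n, 0 ≤ F n)
    (hsum : Summable fun n => (reducedAvoiding R n).card * F n) :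
    Summable fun g : G => F (quotientNorm π g) := by
  classical
  refine summable_of_sum_le (c := ∑' n, (reducedAvoiding R n).card * F n) (fun g => hF _)
    fun T => ?_
  rw [← Finset.sum_fiberwise_of_maps_to (t := T.image (quotientNorm π))
    fun g hg => Finset.mem_image_of_mem _ hg]
  refine le_trans (Finset.sum_le_sum fun n _ => ?_)
    (hsum.sum_le_tsum _ fun n _ => mul_nonneg (Nat.cast_nonneg _) (hF n))
  rw [Finset.sum_congr rfl fun g hg => congrArg F (Finset.mem_filter.1 hg).2, Finset.sum_const,
    nsmul_eq_mul]
  gcongr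
  · exact hF n
  · exact card_filter_quotientNorm_eq_le hπ hR0 hR T n

end QuotientNorm

end FreeGroup

section SphericalFunction

/-- The spherical function of the `(q + 1)`-regular tree at the bottom of the spectrum. -/
def criticalSpherical (q : ℝ) (n : ℕ) : ℝ :=
  (1 + n * ((q - 1) / (q + 1))) * (√q)⁻¹ ^ n

variable {q : ℝ}

theorem criticalSpherical_pos (hq : 1 < q) (n : ℕ) : 0 < criticalSpherical q n := by
  have : 0 < q - 1 := by linarith
  have : 0 < √q := Real.sqrt_pos.2 (by linarith)
  unfold criticalSpherical
  positivity

theorem criticalSpherical_sq (hq : 1 < q) (n : ℕ) :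
    criticalSpherical q n ^ 2 = (1 + n * ((q - 1) / (q + 1))) ^ 2 * (q ^ n)⁻¹ := by
  rw [criticalSpherical, mul_pow, ← pow_mul, mul_comm n 2, pow_mul, inv_pow,
    Real.sq_sqrt (by linarith), inv_pow]

theorem criticalSpherical_strictAnti (hq : 1 < q) : StrictAnti (criticalSpherical q) := by
  refine strictAnti_nat_of_succ_lt fun n => ?_
  have hs : 1 < √q := Real.lt_sqrt_of_sq_lt (by simpa using hq)
  have hsq : √q ^ 2 = q := Real.sq_sqrt (by linarith)
  have hc0 : 0 < (q - 1) / (q + 1) := div_pos (by linarith) (by linarith)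
  have hc : 1 + (q - 1) / (q + 1) < √q := by
    rw [show 1 + (q - 1) / (q + 1) = 2 * q / (q + 1) by
      have : q + 1 ≠ 0 := by linarith
      field_simp; ring, div_lt_iff₀ (by linarith)]
    have : 0 < √q * (√q - 1) ^ 2 := mul_pos (by linarith) (pow_pos (by linarith) 2)
    nlinarith
  have hlt : 1 + ((n : ℝ) + 1) * ((q - 1) / (q + 1)) < √q * (1 + n * ((q - 1) / (q + 1))) := by
    have : 0 ≤ (√q - 1) * (n * ((q - 1) / (q + 1))) :=
      mul_nonneg (by linarith) (by positivity)
    nlinarith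
  unfold criticalSpherical
  rw [pow_succ', ← mul_assoc]
  push_cast
  gcongr
  rw [← div_eq_mul_inv, div_lt_iff₀ (by linarith), mul_comm _ (√q)]
  exact hlt

theorem criticalSpherical_zero_rec (hq : 1 < q) :
    (q + 1) * criticalSpherical q 1 = 2 * √q * criticalSpherical q 0 := by
  have hs : 0 < √q := Real.sqrt_pos.2 (by linarith)
  have hsq : √q ^ 2 = q := Real.sq_sqrt (by linarith)
  have : q + 1 ≠ 0 := by linarith
  simp only [criticalSpherical]
  field_simp
  push_cast
  linear_combination (-2 * (q + 1)) * hsq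

theorem criticalSpherical_succ_rec (hq : 1 < q) (n : ℕ) :
    criticalSpherical q n + q * criticalSpherical q (n + 2) =
      2 * √q * criticalSpherical q (n + 1) := by
  have hs : 0 < √q := Real.sqrt_pos.2 (by linarith)
  have hsq : √q * √q = q := Real.mul_self_sqrt (by linarith)
  have h1 : q * ((√q)⁻¹ * (√q)⁻¹) = 1 := by
    rw [← mul_inv, hsq, mul_inv_cancel₀ (by linarith)]
  have h2 : √q * (√q)⁻¹ = 1 := mul_inv_cancel₀ hs.ne'
  simp only [criticalSpherical, pow_succ]
  push_cast
  linear_combination (1 + (n + 2) * ((q - 1) / (q + 1))) * (√q)⁻¹ ^ n * h1 -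
    2 * (1 + (n + 1) * ((q - 1) / (q + 1))) * (√q)⁻¹ ^ n * h2

end SphericalFunction

namespace FreeGroup

section LowerBound

universe u v

variable {α : Type u} [Fintype α] [DecidableEq α] {G : Type v} [Group G] {π : FreeGroup α →* G}

theorem two_mul_sqrt_mul_criticalSpherical_le {q : ℕ} (hq : Fintype.card (α × Bool) = q + 1)
    (hq2 : 2 ≤ q) (hπ : Function.Surjective π) (g : G) :
    2 * √q * criticalSpherical q (quotientNorm π g) ≤
      ∑ p : α × Bool, criticalSpherical q (quotientNorm π (g * π (mk [p]))) := by
  have hq1 : (1 : ℝ) < q := by exact_mod_cast (by omega : 1 < q)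
  have hanti := (criticalSpherical_strictAnti hq1).antitone
  have hle (p : α × Bool) := hanti (quotientNorm_mul_letter_le hπ g p)
  by_cases hg : g = 1
  · subst hg
    rw [quotientNorm_one, ← criticalSpherical_zero_rec hq1]
    refine le_of_eq_of_le ?_ (Finset.sum_le_sum fun p _ => hle p)
    rw [Finset.sum_const, Finset.card_univ, hq, quotientNorm_one, nsmul_eq_mul]
    push_cast
    rfl
  · obtain ⟨p₀, hp₀⟩ := exists_quotientNorm_mul_letter_lt hπ hg
    obtain ⟨n, hn⟩ := Nat.exists_eq_add_of_le' ((Nat.le_add_left 1 _).trans hp₀)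
    rw [hn] at hp₀ hle
    rw [← Finset.add_sum_erase _ _ (Finset.mem_univ p₀), hn, ← criticalSpherical_succ_rec hq1]
    refine add_le_add (hanti (Nat.le_of_succ_le_succ hp₀))
      (le_of_eq_of_le ?_ (Finset.sum_le_sum fun p _ => hle p))
    rw [Finset.sum_const, Finset.card_erase_of_mem (Finset.mem_univ _), Finset.card_univ, hq,
      nsmul_eq_mul]
    rfl

/-- If the radial critical spherical function is an eigenfunction, then the quotient map is
isometric on reduced words. -/
theorem quotientNorm_mk_eq_length {q : ℕ} (hq : Fintype.card (α × Bool) = q + 1)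
    (hq2 : 2 ≤ q) (hπ : Function.Surjective π)
    (heq : ∀ g, ∑ p : α × Bool, criticalSpherical q (quotientNorm π (g * π (mk [p]))) ≤
      2 * √q * criticalSpherical q (quotientNorm π g))
    {L : List (α × Bool)} (hL : IsReduced L) : quotientNorm π (π (mk L)) = L.length := by
  have hq1 : (1 : ℝ) < q := by exact_mod_cast (by omega : 1 < q)
  have hstrict := criticalSpherical_strictAnti hq1
  have hle (g : G) (p : α × Bool) := hstrict.antitone (quotientNorm_mul_letter_le hπ g p)
  have hinj {s : Finset (α × Bool)} {g : G}
      (hs : ∑ p ∈ s, criticalSpherical q (quotientNorm π (g * π (mk [p]))) ≤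
        s.card * criticalSpherical q (quotientNorm π g + 1)) {p : α × Bool} (hp : p ∈ s) :
      quotientNorm π (g * π (mk [p])) = quotientNorm π g + 1 := by
    rw [← nsmul_eq_mul, ← Finset.sum_const] at hs
    have := (Finset.sum_eq_sum_iff_of_le fun p _ => hle g p).1
      (le_antisymm (Finset.sum_le_sum fun p _ => hle g p) hs) p hp
    exact (hstrict.injective this).symm
  induction L using List.reverseRecOn with
  | nil => rw [← one_eq_mk, _root_.map_one, quotientNorm_one]; rfl
  | append_singleton L p ih =>
    have hLr : IsReduced L := hL.infix (List.prefix_append L [p]).isInfix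
    specialize ih hLr
    rw [← mul_mk, _root_.map_mul, List.length_append, List.length_singleton, ← ih]
    obtain rfl | ⟨W, b, rfl⟩ := L.eq_nil_or_concat
    · refine hinj (s := Finset.univ) (le_of_le_of_eq (heq _) ?_) (Finset.mem_univ p)
      rw [← one_eq_mk, _root_.map_one, quotientNorm_one, ← criticalSpherical_zero_rec hq1,
        Finset.card_univ, hq]
      push_cast
      rfl
    · rw [List.concat_eq_append] at *
      have hW : π (mk (W ++ [b])) * π (mk [(b.1, !b.2)]) = π (mk W) := by
        rw [← _root_.map_mul, ← mul_mk, mul_assoc, mk_letter_mul_inverse, mul_one]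
      rw [List.append_assoc, List.singleton_append, isReduced_append_cons_iff] at hL
      refine hinj (s := Finset.univ.erase (b.1, !b.2)) ?_
        (Finset.mem_erase.2 ⟨hL.2.1, Finset.mem_univ _⟩)
      have h := heq (π (mk (W ++ [b])))
      rw [← Finset.add_sum_erase _ _ (Finset.mem_univ (b.1, !b.2)), hW, ih, List.length_append,
        List.length_singleton, ← criticalSpherical_succ_rec hq1] at h
      have hW' : criticalSpherical q W.length ≤ criticalSpherical q (quotientNorm π (π (mk W))) :=
        hstrict.antitone ((quotientNorm_apply_le _).trans norm_mk_le)
      rw [Finset.card_erase_of_mem (Finset.mem_univ _), Finset.card_univ, hq, ih,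
        List.length_append, List.length_singleton, Nat.add_sub_cancel]
      linarith

/-- Kesten's lower bound for a proper quotient of a free group. -/
theorem sqrt_div_lt_norm_average (hπ : Function.Surjective π) {r : FreeGroup α} (hr : r ≠ 1)
    (hπr : π r = 1) {h : ℕ} (hh : 2 ≤ h) (hcard : Fintype.card α = h)
    {M : lp (fun _ : G => ℂ) 2 →L[ℂ] lp (fun _ : G => ℂ) 2}
    (hM : ∀ (f : lp (fun _ : G => ℂ) 2) g,
      M f g = (2 * (h : ℂ))⁻¹ * ∑ p : α × Bool, f (g * π (mk [p]))) :
    √(2 * h - 1) / h < ‖M‖ := by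
  obtain ⟨q, hq⟩ : ∃ q, 2 * h = q + 1 := ⟨2 * h - 1, by omega⟩
  have hq2 : 2 ≤ q := by omega
  have hq1 : (1 : ℝ) < q := by exact_mod_cast (by omega : 1 < q)
  have hqh : (2 * h : ℝ) = q + 1 := by exact_mod_cast hq
  have hcard' : Fintype.card (α × Bool) = q + 1 := by simp [hcard]; omega
  rw [hqh, add_sub_cancel_right]
  by_contra! hle
  have hR0 : r.toWord ≠ [] := by rwa [ne_eq, toWord_eq_nil_iff]
  have hsum : Summable fun g : G => criticalSpherical q (quotientNorm π g) ^ 2 := by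
    refine summable_comp_quotientNorm (F := fun n => criticalSpherical q n ^ 2) hπ hR0
      (by rwa [mk_toWord]) (fun n => sq_nonneg _) ?_
    refine (summable_card_reducedAvoiding hcard' hq2 (isReduced_toWord (x := r))
      (((q : ℝ) - 1) / (q + 1))).congr fun n => ?_
    rw [criticalSpherical_sq hq1]
    ring
  let f : lp (fun _ : G => ℂ) 2 :=
    ⟨fun g => (criticalSpherical q (quotientNorm π g) : ℂ), memℓp_gen (by
      simpa [Complex.norm_real] using hsum)⟩
  have hf (g : G) : ‖f g‖ = criticalSpherical q (quotientNorm π g) :=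
    (Complex.norm_real _).trans (Real.norm_of_nonneg (criticalSpherical_pos hq1 _).le)
  have hMf (g : G) : ‖M f g‖ = (2 * h : ℝ)⁻¹ *
      ∑ p : α × Bool, criticalSpherical q (quotientNorm π (g * π (mk [p]))) := by
    have : M f g = (((2 * h : ℝ)⁻¹ * ∑ p : α × Bool,
        criticalSpherical q (quotientNorm π (g * π (mk [p]))) : ℝ) : ℂ) := by
      rw [hM]; push_cast; rfl
    rw [this, Complex.norm_real, Real.norm_of_nonneg]
    exact mul_nonneg (by positivity)
      (Finset.sum_nonneg fun p _ => (criticalSpherical_pos hq1 _).le)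
  have hh0 : (0 : ℝ) < h := by positivity
  have hscale (y : ℝ) : √q / h * y = (2 * h : ℝ)⁻¹ * (2 * √q * y) := by field_simp
  have heq := norm_apply_eq_of_opNorm_le hle (f := f) fun g => by
    rw [hf, hMf, hscale]
    gcongr
    exact two_mul_sqrt_mul_criticalSpherical_le hcard' hq2 hπ g
  have hlen := quotientNorm_mk_eq_length hcard' hq2 hπ (fun g => by
    have := heq g
    rw [hf, hMf, hscale] at this
    exact (mul_left_cancel₀ (by positivity) this).le) (isReduced_toWord (x := r))
  rw [mk_toWord, hπr, quotientNorm_one] at hlen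
  exact hR0 (List.length_eq_zero_iff.1 hlen.symm)

end LowerBound

end FreeGroup

theorem CyclicallyReduced.isCyclicallyReduced_toWord {α : Type*} [DecidableEq α] {w : FreeGroup α}
    (hw : CyclicallyReduced w) : FreeGroup.IsCyclicallyReduced w.toWord := by
  refine ⟨FreeGroup.isReduced_toWord, ?_⟩
  rintro ⟨a, b⟩ ha ⟨a', b'⟩ ha' h
  simp only at h ⊢
  subst h
  by_contra hne
  refine hw _ _ ha' (ha.trans ?_)
  rw [Bool.eq_not_of_ne hne]

/-- Corollary 4: for a one-relator group `Γ = F/⟨⟨r⟩⟩` on `h ≥ 2` generators, with `r`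
nontrivial and cyclically reduced, and whose symmetric generating set `S` (the image of
`S_+ ∪ S_+⁻¹`) consists of `2h` pairwise distinct nontrivial elements, one has
`√(2h−1)/h < μ(Γ,S) ≤ (√(2h−3) + 1)/h`. -/
theorem one_relator_bound {α : Type*} [Fintype α] [DecidableEq α]
    (h : ℕ) (hh : 2 ≤ h) (hcard : Fintype.card α = h)
    (r : FreeGroup α) (hr : r ≠ 1) (hcr : CyclicallyReduced r)
    (hinj : Function.Injective fun p : α × Bool =>
      if p.2 then (PresentedGroup.of (rels := ({r} : Set (FreeGroup α))) p.1)⁻¹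
      else PresentedGroup.of p.1)
    (hnt : ∀ p : α × Bool,
      (if p.2 then (PresentedGroup.of (rels := ({r} : Set (FreeGroup α))) p.1)⁻¹
       else PresentedGroup.of p.1) ≠ 1)
    (S : Finset (PresentedGroup ({r} : Set (FreeGroup α))))
    (hS : (S : Set (PresentedGroup ({r} : Set (FreeGroup α)))) =
      Set.range fun p : α × Bool =>
        if p.2 then (PresentedGroup.of (rels := ({r} : Set (FreeGroup α))) p.1)⁻¹
        else PresentedGroup.of p.1)
    (M : lp (fun _ : PresentedGroup ({r} : Set (FreeGroup α)) => ℂ) 2 →L[ℂ]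
      lp (fun _ : PresentedGroup ({r} : Set (FreeGroup α)) => ℂ) 2)
    (hM : ∀ (f : lp (fun _ : PresentedGroup ({r} : Set (FreeGroup α)) => ℂ) 2)
      (x : PresentedGroup ({r} : Set (FreeGroup α))),
      M f x = (2 * (h : ℂ))⁻¹ * ∑ s ∈ S, f (x * s)) :
    Real.sqrt (2 * (h : ℝ) - 1) / h < ‖M‖ ∧
      ‖M‖ ≤ (Real.sqrt (2 * (h : ℝ) - 3) + 1) / h := by
  have hmk (p : α × Bool) :
      (if p.2 then (PresentedGroup.of (rels := ({r} : Set (FreeGroup α))) p.1)⁻¹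
        else PresentedGroup.of p.1) =
      PresentedGroup.mk {r} (FreeGroup.mk [(p.1, !p.2)]) := by
    obtain ⟨a, b | b⟩ := p
    · rfl
    · rfl
  have hM' (f : lp (fun _ : PresentedGroup ({r} : Set (FreeGroup α)) => ℂ) 2)
      (g : PresentedGroup ({r} : Set (FreeGroup α))) : M f g = (2 * (h : ℂ))⁻¹ *
        ∑ p : α × Bool, f (g * PresentedGroup.mk {r} (FreeGroup.mk [p])) := by
    classical
    have hSimage : S = Finset.univ.image fun p : α × Bool =>
        if p.2 then (PresentedGroup.of (rels := ({r} : Set (FreeGroup α))) p.1)⁻¹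
        else PresentedGroup.of p.1 := by
      rw [← Finset.coe_inj, hS, Finset.coe_image, Finset.coe_univ, Set.image_univ]
    rw [hM, hSimage, Finset.sum_image hinj.injOn]
    congr 1
    exact Fintype.sum_equiv ((Equiv.refl α).prodCongr Equiv.boolNot) _ _
      fun p => congrArg (fun s => f (g * s)) (hmk p)
  have hr0 : r.toWord ≠ [] := by rwa [ne_eq, FreeGroup.toWord_eq_nil_iff]
  obtain ⟨⟨x, b⟩, hx⟩ := List.exists_mem_of_ne_nil _ hr0
  have hfree := (FreeGroup.freiheitssatz hcr.isCyclicallyReduced_toWord ⟨b, hx⟩).injective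
  rw [FreeGroup.mk_toWord] at hfree
  exact ⟨FreeGroup.sqrt_div_lt_norm_average (PresentedGroup.mk_surjective {r}) hr
    (PresentedGroup.one_of_mem (Set.mem_singleton r)) hh hcard hM', FreeGroup.norm_average_le hfree hh hcard hM'⟩
end
end

section
/- There exists a constant C > 0 such that |μ_g − 1/√g| ≤ C/g for every integer g ≥ 2; i.e. μ_g = g^{−1/2} + O(g^{−1}) as g → ∞. -/
open scoped Real

noncomputable section

/-- The surface relator `∏_{j=1}^g a_j b_j a_j⁻¹ b_j⁻¹` in the free group on the
`2g` generators `a_1, b_1, …, a_g, b_g`, where `(j, false)` stands for `a_j` and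
`(j, true)` stands for `b_j`. -/
def surfaceRel (g : ℕ) : FreeGroup (Fin g × Bool) :=
  ((List.finRange g).map fun j =>
    FreeGroup.of (j, false) * FreeGroup.of (j, true) *
      (FreeGroup.of (j, false))⁻¹ * (FreeGroup.of (j, true))⁻¹).prod

/-- The fundamental group `Γ_g` of the closed orientable surface of genus `g`:
the quotient of the free group on `a_1, b_1, …, a_g, b_g` by the normal closure
of `∏_{j=1}^g a_j b_j a_j⁻¹ b_j⁻¹`. -/
abbrev SurfaceGroup (g : ℕ) :=
  PresentedGroup ({surfaceRel g} : Set (FreeGroup (Fin g × Bool)))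

/-- Enumeration of the `4g` elements `a_j, a_j⁻¹, b_j, b_j⁻¹` of `S_g`:
`(j, w, i)` is `a_j` (if `w = false`) or `b_j` (if `w = true`), inverted when `i = true`. -/
def sgenFun (g : ℕ) (p : Fin g × Bool × Bool) : SurfaceGroup g :=
  if p.2.2 then (PresentedGroup.of (p.1, p.2.1))⁻¹ else PresentedGroup.of (p.1, p.2.1)

open scoped Classical in
/-- The symmetric generating set `S_g = {a_1^{±1}, b_1^{±1}, …, a_g^{±1}, b_g^{±1}}`
of `Γ_g`. -/
def Sgen (g : ℕ) : Finset (SurfaceGroup g) :=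
  Finset.image (sgenFun g) Finset.univ

/-- `M` is the Markov operator of the simple random walk on `(Γ_g, S_g)`, i.e. the
bounded operator on `ℓ²(Γ_g)` given by `(M f)(x) = (1/(4g)) ∑_{s ∈ S_g} f(xs)`;
`μ_g` is by definition its operator norm `‖M‖`. -/
def IsMarkov (g : ℕ)
    (M : lp (fun _ : SurfaceGroup g => ℂ) 2 →L[ℂ] lp (fun _ : SurfaceGroup g => ℂ) 2) :
    Prop :=
  ∀ (f : lp (fun _ : SurfaceGroup g => ℂ) 2) (x : SurfaceGroup g),
    M f x = (4 * (g : ℂ))⁻¹ * ∑ s ∈ Sgen g, f (x * s)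

namespace FreeGroup

variable {β : Type*}

/-- The letter inverse to `l`. -/
def invLetter (l : β × Bool) : β × Bool := (l.1, !l.2)

@[simp]
theorem invLetter_invLetter (l : β × Bool) : invLetter (invLetter l) = l := by
  simp [invLetter]

theorem mk_invLetter (l : β × Bool) : mk [invLetter l] = (mk [l])⁻¹ := by
  simp [invLetter, inv_mk, invRev]

variable [DecidableEq β]

/-- The letter by which one has to multiply `x` on the right to cancel its last letter. -/
def parentLetter (x : FreeGroup β) : Option (β × Bool) := (toWord x⁻¹).head?

theorem toWord_inv_mul_mk (x : FreeGroup β) (l : β × Bool) :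
    toWord (x * mk [l])⁻¹ = reduce (invLetter l :: toWord x⁻¹) := by
  rw [mul_inv_rev, ← mk_invLetter, toWord_mul, toWord_mk, reduce_singleton, List.singleton_append]

theorem norm_mul_mk_of_parentLetter_eq {x : FreeGroup β} {l : β × Bool}
    (h : parentLetter x = some l) : norm (x * mk [l]) + 1 = norm x := by
  rw [← norm_inv_eq, ← norm_inv_eq (x := x), norm, norm, toWord_inv_mul_mk, reduce.cons,
    reduce_toWord]
  unfold parentLetter at h
  cases hw : toWord x⁻¹ with
  | nil => simp [hw] at h
  | cons a t =>
    simp only [hw, List.head?_cons, Option.some.injEq] at h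
    subst h
    simp [invLetter]

theorem toWord_inv_mul_mk_of_parentLetter_ne {x : FreeGroup β} {l : β × Bool}
    (h : parentLetter x ≠ some l) : toWord (x * mk [l])⁻¹ = invLetter l :: toWord x⁻¹ := by
  rw [toWord_inv_mul_mk, reduce.cons, reduce_toWord]
  unfold parentLetter at h
  cases hw : toWord x⁻¹ with
  | nil => rfl
  | cons a t =>
    simp only [hw, List.head?_cons, ne_eq, Option.some.injEq] at h
    have : ¬ ((invLetter l).1 = a.1 ∧ (invLetter l).2 = !a.2) := by
      rintro ⟨h1, h2⟩
      simp only [invLetter, Bool.not_inj_iff] at h1 h2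
      exact h (Prod.ext h1.symm h2.symm)
    simp [this]

theorem norm_mul_mk_of_parentLetter_ne {x : FreeGroup β} {l : β × Bool}
    (h : parentLetter x ≠ some l) : norm (x * mk [l]) = norm x + 1 := by
  rw [← norm_inv_eq, ← norm_inv_eq (x := x), norm, norm, toWord_inv_mul_mk_of_parentLetter_ne h,
    List.length_cons]

theorem parentLetter_mul_mk {x : FreeGroup β} {l : β × Bool}
    (h : parentLetter x ≠ some l) : parentLetter (x * mk [l]) = some (invLetter l) := by
  rw [parentLetter, toWord_inv_mul_mk_of_parentLetter_ne h, List.head?_cons]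

theorem exists_parentLetter {x : FreeGroup β} (h : x ≠ 1) : ∃ l, parentLetter x = some l := by
  unfold parentLetter
  cases hw : toWord x⁻¹ with
  | nil => exact absurd (inv_eq_one.1 (toWord_eq_nil_iff.1 hw)) h
  | cons a t => exact ⟨a, rfl⟩

theorem finite_setOf_norm_eq [Finite β] (k : ℕ) : {x : FreeGroup β | norm x = k}.Finite :=
  Set.Finite.of_finite_image ((List.finite_length_eq (β × Bool) k).subset
    (by rintro _ ⟨x, hx, rfl⟩; exact hx)) (toWord_injective.injOn)

/-- The sphere of radius `k` around `1` in the free group. -/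
def sphere (β : Type*) [DecidableEq β] [Finite β] (k : ℕ) : Finset (FreeGroup β) :=
  (finite_setOf_norm_eq (β := β) k).toFinset

theorem mem_sphere [Finite β] {k : ℕ} {x : FreeGroup β} : x ∈ sphere β k ↔ norm x = k := by
  simp [sphere]

theorem card_sphere_succ_eq_sum [Fintype β] (k : ℕ) :
    (sphere β (k + 1)).card =
      ∑ x ∈ sphere β k, (Finset.univ.filter fun l => parentLetter x ≠ some l).card := by
  rw [← Finset.card_sigma]
  symm
  refine Finset.card_bij (fun a _ => a.1 * mk [a.2]) ?_ ?_ ?_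
  · rintro ⟨x, l⟩ h
    simp only [Finset.mem_sigma, mem_sphere, Finset.mem_filter, Finset.mem_univ, true_and] at h ⊢
    rw [norm_mul_mk_of_parentLetter_ne h.2, h.1]
  · rintro ⟨x, l⟩ h ⟨y, m⟩ h' hxy
    simp only [Finset.mem_sigma, mem_sphere, Finset.mem_filter, Finset.mem_univ, true_and]
      at h h' hxy
    have h1 := parentLetter_mul_mk h.2
    rw [hxy, parentLetter_mul_mk h'.2, Option.some.injEq] at h1
    have h2 : m = l := by simpa using congrArg invLetter h1
    subst h2
    simpa using hxy
  · intro y hy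
    rw [mem_sphere] at hy
    obtain ⟨l, hl⟩ := exists_parentLetter (x := y) (by rintro rfl; simp at hy)
    have hn := norm_mul_mk_of_parentLetter_eq hl
    have hc : y * mk [l] * mk [invLetter l] = y := by rw [mk_invLetter, mul_inv_cancel_right]
    refine ⟨⟨y * mk [l], invLetter l⟩, ?_, hc⟩
    simp only [Finset.mem_sigma, mem_sphere, Finset.mem_filter, Finset.mem_univ, true_and]
    refine ⟨by omega, fun h => ?_⟩
    have := norm_mul_mk_of_parentLetter_eq h
    rw [hc] at this
    omega

theorem card_sphere_succ_add [Fintype β] {k : ℕ} (hk : k ≠ 0) :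
    (sphere β (k + 1)).card + (sphere β k).card = 2 * Fintype.card β * (sphere β k).card := by
  rw [card_sphere_succ_eq_sum, Finset.card_eq_sum_ones (sphere β k), ← Finset.sum_add_distrib,
    Finset.mul_sum]
  refine Finset.sum_congr rfl fun x hx => ?_
  rw [mem_sphere] at hx
  obtain ⟨l, hl⟩ := exists_parentLetter (x := x) (by rintro rfl; simp at hx; omega)
  have h1 : (Finset.univ.filter fun m => parentLetter x ≠ some m) = Finset.univ.erase l := by
    ext m
    simp [hl, eq_comm]
  rw [h1, Finset.card_erase_add_one (Finset.mem_univ l), Finset.card_univ, Fintype.card_prod,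
    Fintype.card_bool]
  ring

theorem card_sphere_zero [Finite β] : (sphere β 0).card = 1 := by
  rw [Finset.card_eq_one]
  exact ⟨1, by ext; simp [mem_sphere]⟩

theorem card_sphere_one [Fintype β] : (sphere β 1).card = 2 * Fintype.card β := by
  have h : sphere β 0 = {1} := by ext; simp [mem_sphere]
  have h1 : (Finset.univ.filter fun m : β × Bool => parentLetter 1 ≠ some m) = Finset.univ := by
    ext m
    simp [parentLetter]
  rw [card_sphere_succ_eq_sum, h, Finset.sum_singleton, h1, Finset.card_univ, Fintype.card_prod,
    Fintype.card_bool, mul_comm]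

end FreeGroup

namespace SurfaceGroup

variable {F : Type*} [Group F]

/-- `F` acting by left translation on the `0`-th copy of `F` in `F × ℤ`. -/
def actZero : F →* Equiv.Perm (F × ℤ) where
  toFun x :=
    { toFun := fun p => if p.2 = 0 then (x * p.1, p.2) else p
      invFun := fun p => if p.2 = 0 then (x⁻¹ * p.1, p.2) else p
      left_inv := fun ⟨y, n⟩ => by by_cases h : n = 0 <;> simp [h]
      right_inv := fun ⟨y, n⟩ => by by_cases h : n = 0 <;> simp [h] }
  map_one' := by ext p : 1; by_cases h : p.2 = 0 <;> simp
  map_mul' x y := by ext p : 1; by_cases h : p.2 = 0 <;> simp [h, mul_assoc]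

theorem actZero_injective : Function.Injective (actZero (F := F)) := fun x y h => by
  simpa [actZero] using congrArg (fun e : Equiv.Perm (F × ℤ) => (e (1, 0)).1) h

/-- Left translation by `w` on all copies of `F` in `F × ℤ` of nonnegative index. -/
def actNonneg (w : F) : Equiv.Perm (F × ℤ) where
  toFun p := if 0 ≤ p.2 then (w * p.1, p.2) else p
  invFun p := if 0 ≤ p.2 then (w⁻¹ * p.1, p.2) else p
  left_inv p := by by_cases h : 0 ≤ p.2 <;> simp [h]
  right_inv p := by by_cases h : 0 ≤ p.2 <;> simp [h]

/-- The shift of the copies of `F` in `F × ℤ`. -/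
def shift : Equiv.Perm (F × ℤ) := (Equiv.refl F).prodCongr (Equiv.addRight (1 : ℤ))

theorem commutator_actNonneg_shift (w : F) :
    actNonneg w * shift * (actNonneg w)⁻¹ * shift⁻¹ = actZero w := by
  ext p : 1
  obtain ⟨y, n⟩ := p
  have h1 : (shift⁻¹ : Equiv.Perm (F × ℤ)) (y, n) = (y, n - 1) := rfl
  have h2 : (actNonneg w)⁻¹ (y, n - 1) = if 0 ≤ n - 1 then (w⁻¹ * y, n - 1) else (y, n - 1) := rfl
  have h3 (z : F) : shift (z, n - 1) = (z, n) := by simp [shift]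
  simp only [Equiv.Perm.mul_apply, h1, h2]
  rcases lt_trichotomy n 0 with h | h | h
  · rw [if_neg (by omega), h3]
    simp [actNonneg, actZero, h.ne, not_le.2 h]
  · rw [if_neg (by omega), h3]
    simp [actNonneg, actZero, h]
  · rw [if_pos (by omega), h3]
    simp [actNonneg, actZero, h.ne', h.le]

/-- The homomorphism from the free group on `a_1, b_1, …, a_m, b_m` to `Γ_{m+1}`. -/
def ofFree (m : ℕ) : FreeGroup (Fin m × Bool) →* SurfaceGroup (m + 1) :=
  FreeGroup.lift fun p => PresentedGroup.of (p.1.castSucc, p.2)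

theorem map_surfaceRel {H : Type*} [Group H] {m : ℕ} (f : Fin (m + 1) × Bool → H) :
    FreeGroup.lift f (surfaceRel (m + 1)) =
      FreeGroup.lift (fun p : Fin m × Bool => f (p.1.castSucc, p.2)) (surfaceRel m) *
        (f (Fin.last m, false) * f (Fin.last m, true) * (f (Fin.last m, false))⁻¹ *
          (f (Fin.last m, true))⁻¹) := by
  simp [surfaceRel, List.finRange_succ_last, map_list_prod, Function.comp_def]

theorem ofFree_injective (m : ℕ) : Function.Injective (ofFree m) := by
  let F := FreeGroup (Fin m × Bool)
  let f : Fin (m + 1) × Bool → Equiv.Perm (F × ℤ) := fun p =>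
    Fin.lastCases (motive := fun _ => Equiv.Perm (F × ℤ))
      (if p.2 then shift else actNonneg (surfaceRel m)⁻¹)
      (fun j => actZero (FreeGroup.of (j, p.2))) p.1
  have hf : (FreeGroup.lift fun p : Fin m × Bool => f (p.1.castSucc, p.2)) = actZero := by
    ext1 p
    simp [f]
  have hrel : ∀ r ∈ ({surfaceRel (m + 1)} : Set (FreeGroup (Fin (m + 1) × Bool))),
      FreeGroup.lift f r = 1 := by
    rintro r rfl
    rw [map_surfaceRel, hf]
    simp only [f, Fin.lastCases_last, if_true, Bool.false_eq_true, if_false]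
    rw [commutator_actNonneg_shift, ← map_mul, mul_inv_cancel, map_one]
  have hcomp : (PresentedGroup.toGroup hrel).comp (ofFree m) = actZero := by
    rw [← hf]
    ext1 p
    simp [ofFree, PresentedGroup.toGroup.of]
  refine Function.Injective.of_comp (f := PresentedGroup.toGroup hrel) ?_
  rw [← MonoidHom.coe_comp, hcomp]
  exact actZero_injective

theorem sgenFun_injective (g : ℕ) : Function.Injective (sgenFun g) := by
  let f : Fin g × Bool → Multiplicative (Fin g × Bool → ℤ) := fun p =>
    Multiplicative.ofAdd (Pi.single p 1)
  have hrel : ∀ r ∈ ({surfaceRel g} : Set (FreeGroup (Fin g × Bool))),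
      FreeGroup.lift f r = 1 := by
    rintro r rfl
    rw [surfaceRel, map_list_prod, List.map_map]
    refine List.prod_eq_one fun x hx => ?_
    obtain ⟨j, -, rfl⟩ := List.mem_map.1 hx
    simp only [Function.comp_apply, map_mul, map_inv, FreeGroup.lift_apply_of]
    rw [mul_right_comm, mul_inv_cancel_right, mul_inv_cancel]
  have key (p : Fin g × Bool × Bool) (i : Fin g × Bool) :
      Multiplicative.toAdd (PresentedGroup.toGroup hrel (sgenFun g p)) i =
        if i = (p.1, p.2.1) then (if p.2.2 then -1 else 1) else 0 := by
    obtain ⟨j, w, b⟩ := p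
    cases b <;> simp [sgenFun, PresentedGroup.toGroup.of, f, Pi.single_apply, apply_ite]
  intro p q h
  have h1 := key p (p.1, p.2.1)
  rw [h, key q] at h1
  obtain ⟨j, w, b⟩ := p
  obtain ⟨j', w', b'⟩ := q
  by_cases h2 : (j, w) = (j', w')
  · simp only [h2, if_true] at h1
    simp only [Prod.mk.injEq] at h2
    cases b <;> cases b' <;> simp_all
  · simp only [h2, if_false, if_true] at h1
    cases b <;> simp at h1

end SurfaceGroup

namespace RightTranslation

variable {G : Type*}

theorem summable_norm_sq (f : lp (fun _ : G => ℂ) 2) : Summable fun x => ‖f x‖ ^ 2 := by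
  have h := (memℓp_gen_iff (p := 2) (by simp)).1 (lp.memℓp f)
  simpa using h

theorem norm_sq_eq_tsum (f : lp (fun _ : G => ℂ) 2) : ‖f‖ ^ 2 = ∑' x, ‖f x‖ ^ 2 := by
  have h := lp.norm_rpow_eq_tsum (p := 2) (by simp) f
  simpa using h

theorem memℓp_two_of_summable {f : G → ℂ} (h : Summable fun x => ‖f x‖ ^ 2) :
    Memℓp f 2 := by
  refine memℓp_gen ?_
  simpa using h

variable [Group G]

/-- Right translation by `s` on `ℓ²(G)`. -/
def rtrans (s : G) (f : lp (fun _ : G => ℂ) 2) : lp (fun _ : G => ℂ) 2 :=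
  ⟨fun x => f (x * s), memℓp_two_of_summable
    ((Equiv.mulRight s).summable_iff.2 (summable_norm_sq f))⟩

@[simp]
theorem rtrans_apply (s : G) (f : lp (fun _ : G => ℂ) 2) (x : G) : rtrans s f x = f (x * s) := rfl

theorem norm_rtrans (s : G) (f : lp (fun _ : G => ℂ) 2) : ‖rtrans s f‖ = ‖f‖ := by
  rw [← sq_eq_sq₀ (norm_nonneg _) (norm_nonneg _), norm_sq_eq_tsum, norm_sq_eq_tsum]
  exact (Equiv.mulRight s).tsum_eq fun x => ‖f x‖ ^ 2

theorem sq_sum_le_of_choice {L : Type*} [Fintype L] [DecidableEq L] (a : L → ℝ)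
    (ha : ∀ l, 0 ≤ a l) (o : Option L) (P : L → Prop) [DecidablePred P]
    (h : ∀ l, o = some l ∨ P l) :
    (∑ l, a l) ^ 2 ≤
      2 * ∑ l, a l ^ 2 + 2 * (Fintype.card L * ∑ l, if P l then a l ^ 2 else 0) := by
  have h1 : ∑ l, a l ≤ (∑ l, if o = some l then a l else 0) + ∑ l, if P l then a l else 0 := by
    rw [← Finset.sum_add_distrib]
    refine Finset.sum_le_sum fun l _ => ?_
    have := ha l
    rcases h l with h | h
    · by_cases h' : P l <;> simp [h, h', this]
    · by_cases h' : o = some l <;> simp [h, h', this]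
  have h2 : (∑ l, if o = some l then a l else 0) ^ 2 ≤ ∑ l, a l ^ 2 := by
    cases o with
    | none => simpa using Finset.sum_nonneg fun l _ => sq_nonneg (a l)
    | some k =>
      simpa using Finset.single_le_sum (f := fun l => a l ^ 2) (fun l _ => sq_nonneg (a l))
        (Finset.mem_univ k)
  have h3 : (∑ l, if P l then a l else 0) ^ 2 ≤
      Fintype.card L * ∑ l, if P l then a l ^ 2 else 0 := by
    simpa [ite_pow] using sq_sum_le_card_mul_sum_sq (s := Finset.univ)
      (f := fun l => if P l then a l else 0)
  have h4 : 0 ≤ ∑ l, a l := Finset.sum_nonneg fun l _ => ha l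
  calc (∑ l, a l) ^ 2
      ≤ ((∑ l, if o = some l then a l else 0) + ∑ l, if P l then a l else 0) ^ 2 := by gcongr
    _ ≤ 2 * ((∑ l, if o = some l then a l else 0) ^ 2 + (∑ l, if P l then a l else 0) ^ 2) :=
        add_sq_le
    _ ≤ _ := by linarith

set_option maxHeartbeats 1000000 in
/-- If every edge `x — x * r l` of a Cayley graph joins one of its end points to the parent of
that end point, then the adjacency operator has norm at most `2 √d`. -/
theorem norm_sum_rtrans_le {L : Type*} [Fintype L] (r : L → G) (inv : L → L)
    (hinv : Function.Injective inv) (p : G → Option L)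
    (hp : ∀ x l, p x = some l ∨ p (x * r l) = some (inv l)) (f : lp (fun _ : G => ℂ) 2) :
    ‖∑ l, rtrans (r l) f‖ ≤ 2 * √(Fintype.card L) * ‖f‖ := by
  classical
  refine le_of_sq_le_sq ?_ (by positivity)
  rw [mul_pow, mul_pow, Real.sq_sqrt (Nat.cast_nonneg _), norm_sq_eq_tsum]
  have hs (l : L) : Summable fun x => ‖f (x * r l)‖ ^ 2 := summable_norm_sq (rtrans (r l) f)
  have hi (l : L) : Summable fun y => if p y = some (inv l) then ‖f y‖ ^ 2 else 0 :=
    Summable.of_nonneg_of_le (fun y => by split_ifs <;> positivity)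
      (fun y => by split_ifs <;> simp) (summable_norm_sq f)
  have ht (l : L) :
      Summable fun x => if p (x * r l) = some (inv l) then ‖f (x * r l)‖ ^ 2 else 0 :=
    (Equiv.mulRight (r l)).summable_iff.2 (hi l)
  have hA : Summable fun x => ∑ l, ‖f (x * r l)‖ ^ 2 := summable_sum fun l _ => hs l
  have hB : Summable fun x =>
      ∑ l, if p (x * r l) = some (inv l) then ‖f (x * r l)‖ ^ 2 else 0 :=
    summable_sum fun l _ => ht l
  have hpt (x : G) : ‖(∑ l, rtrans (r l) f : lp (fun _ : G => ℂ) 2) x‖ ^ 2 ≤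
      2 * ∑ l, ‖f (x * r l)‖ ^ 2 + 2 * (Fintype.card L *
        ∑ l, if p (x * r l) = some (inv l) then ‖f (x * r l)‖ ^ 2 else 0) := by
    refine le_trans ?_ (sq_sum_le_of_choice (fun l => ‖f (x * r l)‖) (fun l => norm_nonneg _)
      (p x) (fun l => p (x * r l) = some (inv l)) (hp x))
    gcongr
    rw [lp.coeFn_sum, Finset.sum_apply]
    exact norm_sum_le _ _
  have h1 : ∑' x, ∑ l, ‖f (x * r l)‖ ^ 2 = Fintype.card L * ‖f‖ ^ 2 := by
    rw [Summable.tsum_finsetSum fun l _ => hs l]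
    have (l : L) : ∑' x, ‖f (x * r l)‖ ^ 2 = ‖f‖ ^ 2 := by
      rw [← norm_rtrans (r l) f, norm_sq_eq_tsum]
      rfl
    simp [this]
  have h2 : ∑' x, (∑ l, if p (x * r l) = some (inv l) then ‖f (x * r l)‖ ^ 2 else 0) ≤
      ‖f‖ ^ 2 := by
    rw [Summable.tsum_finsetSum fun l _ => ht l]
    have (l : L) : (∑' x, if p (x * r l) = some (inv l) then ‖f (x * r l)‖ ^ 2 else 0) =
        ∑' y, if p y = some (inv l) then ‖f y‖ ^ 2 else 0 :=
      (Equiv.mulRight (r l)).tsum_eq fun y => if p y = some (inv l) then ‖f y‖ ^ 2 else 0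
    simp only [this]
    rw [← Summable.tsum_finsetSum fun l _ => hi l, norm_sq_eq_tsum]
    refine Summable.tsum_le_tsum (fun y => ?_) (summable_sum fun l _ => hi l) (summable_norm_sq f)
    rw [← Finset.sum_filter, Finset.sum_const, nsmul_eq_mul]
    have hc : (Finset.univ.filter fun l => p y = some (inv l)).card ≤ 1 := by
      refine Finset.card_le_one.2 fun a ha b hb => hinv ?_
      simp only [Finset.mem_filter, Finset.mem_univ, true_and] at ha hb
      exact Option.some.inj (ha.symm.trans hb)
    have hc' : ((Finset.univ.filter fun l => p y = some (inv l)).card : ℝ) ≤ 1 := by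
      exact_mod_cast hc
    exact mul_le_of_le_one_left (by positivity) hc'
  calc ∑' x, ‖(∑ l, rtrans (r l) f : lp (fun _ : G => ℂ) 2) x‖ ^ 2
      ≤ ∑' x, (2 * ∑ l, ‖f (x * r l)‖ ^ 2 + 2 * (Fintype.card L *
        ∑ l, if p (x * r l) = some (inv l) then ‖f (x * r l)‖ ^ 2 else 0)) :=
        Summable.tsum_le_tsum hpt (summable_norm_sq _)
          ((hA.mul_left _).add ((hB.mul_left _).mul_left _))
    _ = 2 * (Fintype.card L * ‖f‖ ^ 2) + 2 * (Fintype.card L *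
        ∑' x, (∑ l, if p (x * r l) = some (inv l) then ‖f (x * r l)‖ ^ 2 else 0)) := by
        rw [(hA.mul_left _).tsum_add ((hB.mul_left _).mul_left _), tsum_mul_left, tsum_mul_left,
          tsum_mul_left, h1]
    _ ≤ 2 * (Fintype.card L * ‖f‖ ^ 2) + 2 * (Fintype.card L * ‖f‖ ^ 2) := by gcongr
    _ = _ := by ring

open FreeGroup

variable {β : Type*} {ι : FreeGroup β →* G}

/-- The radial function `x ↦ t ^ |x|`, truncated to a ball of the free group and extended by zero
along `ι`. -/
def radial [DecidableEq β] (ι : FreeGroup β →* G) (t : ℝ) (R : ℕ) : G → ℝ :=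
  Function.extend ι (fun h => if norm h ≤ R then t ^ norm h else 0) 0

theorem radial_apply [DecidableEq β] (hι : Function.Injective ι) (t : ℝ) (R : ℕ)
    (h : FreeGroup β) : radial ι t R (ι h) = if norm h ≤ R then t ^ norm h else 0 :=
  hι.extend_apply _ _ _

theorem radial_nonneg [DecidableEq β] (hι : Function.Injective ι) {t : ℝ} (ht : 0 ≤ t) (R : ℕ)
    (x : G) : 0 ≤ radial ι t R x := by
  by_cases hx : ∃ h, ι h = x
  · obtain ⟨h, rfl⟩ := hx
    rw [radial_apply hι]
    split_ifs <;> positivity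
  · rw [radial, Function.extend_apply' _ _ _ hx]
    rfl

variable [Fintype β]

theorem norm_sum_rtrans_freeGroup_le (hι : Function.Injective ι) (f : lp (fun _ : G => ℂ) 2) :
    ‖∑ l : β × Bool, rtrans (ι (mk [l])) f‖ ≤ 2 * √(2 * Fintype.card β) * ‖f‖ := by
  classical
  have hcoset (x : G) : ∃ h, x = (QuotientGroup.mk x : G ⧸ ι.range).out * ι h := by
    obtain ⟨⟨_, h, rfl⟩, hh⟩ := QuotientGroup.mk_out_eq_mul ι.range x
    exact ⟨h⁻¹, by rw [hh, _root_.map_inv]; exact (mul_inv_cancel_right _ _).symm⟩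
  choose h hh using hcoset
  have hmul (x : G) (u : FreeGroup β) : h (x * ι u) = h x * u := by
    have h1 : (QuotientGroup.mk (x * ι u) : G ⧸ ι.range) = QuotientGroup.mk x :=
      QuotientGroup.mk_mul_of_mem x ⟨u, rfl⟩
    have h2 := hh (x * ι u)
    rw [h1] at h2
    nth_rewrite 1 [hh x] at h2
    rw [mul_assoc, ← _root_.map_mul] at h2
    exact (hι (mul_left_cancel h2)).symm
  have := norm_sum_rtrans_le (fun l : β × Bool => ι (mk [l])) invLetter
    (Function.LeftInverse.injective invLetter_invLetter) (fun x => parentLetter (h x))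
    (fun x l => by
      rw [hmul]
      exact or_iff_not_imp_left.2 parentLetter_mul_mk) f
  simpa [mul_comm] using this

theorem card_sphere_mul_pow [DecidableEq β] {t : ℝ}
    (ht : t ^ 2 * (2 * Fintype.card β - 1) = 1) (j : ℕ) :
    ((sphere β (j + 1)).card : ℝ) * (t ^ (j + 1)) ^ 2 = 2 * Fintype.card β * t ^ 2 := by
  induction j with
  | zero =>
    rw [zero_add, card_sphere_one]
    push_cast
    ring
  | succ j ih =>
    have h : ((sphere β (j + 1 + 1)).card : ℝ) =
        (2 * Fintype.card β - 1) * (sphere β (j + 1)).card := by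
      have := card_sphere_succ_add (β := β) (Nat.succ_ne_zero j)
      have h' : ((sphere β (j + 1 + 1)).card : ℝ) + (sphere β (j + 1)).card =
          2 * Fintype.card β * (sphere β (j + 1)).card := by exact_mod_cast this
      linarith
    rw [h, ← ih]
    linear_combination ((sphere β (j + 1)).card * (t ^ (j + 1)) ^ 2 : ℝ) * ht

theorem pairwiseDisjoint_sphere [DecidableEq β] (s : Set ℕ) :
    s.PairwiseDisjoint (sphere β) := fun _ _ _ _ hij =>
  Finset.disjoint_left.2 fun _ hi hj => hij ((mem_sphere.1 hi).symm.trans (mem_sphere.1 hj))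

theorem hasSum_radial_sq [DecidableEq β] (hι : Function.Injective ι) (t : ℝ) (R : ℕ) :
    HasSum (fun x => radial ι t R x ^ 2)
      (∑ k ∈ Finset.range (R + 1), (sphere β k).card * (t ^ k) ^ 2) := by
  rw [← hι.hasSum_iff fun x hx => by
    rw [radial, Function.extend_apply' _ _ _ (by simpa using hx)]
    simp]
  have h1 : ∑ k ∈ Finset.range (R + 1), ((sphere β k).card : ℝ) * (t ^ k) ^ 2 =
      ∑ h ∈ (Finset.range (R + 1)).biUnion (sphere β), radial ι t R (ι h) ^ 2 := by
    rw [Finset.sum_biUnion (pairwiseDisjoint_sphere _)]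
    refine Finset.sum_congr rfl fun k hk => ?_
    rw [← nsmul_eq_mul, ← Finset.sum_const]
    refine Finset.sum_congr rfl fun h hh => ?_
    rw [Finset.mem_range] at hk
    rw [radial_apply hι, mem_sphere.1 hh, if_pos (by omega)]
  rw [h1]
  refine hasSum_sum_of_ne_finset_zero fun h hh => ?_
  have : ¬ norm h ≤ R := fun hn =>
    hh (Finset.mem_biUnion.2 ⟨norm h, Finset.mem_range.2 (by omega), mem_sphere.2 rfl⟩)
  simp [radial_apply hι, this]

theorem le_sum_radial [DecidableEq β] (hι : Function.Injective ι) {t : ℝ} {R j : ℕ}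
    (hj : j + 2 ≤ R) {h : FreeGroup β} (hh : norm h = j + 1) :
    ∑ l : β × Bool, radial ι t R (ι h * ι (mk [l])) =
      t ^ j + (2 * Fintype.card β - 1) * t ^ (j + 2) := by
  obtain ⟨l, hl⟩ := exists_parentLetter (x := h) (by rintro rfl; simp at hh)
  have hc : ((Finset.univ.erase l).card : ℝ) = 2 * Fintype.card β - 1 := by
    rw [Finset.cast_card_erase_of_mem (Finset.mem_univ l), Finset.card_univ, Fintype.card_prod,
      Fintype.card_bool]
    push_cast
    ring
  rw [← Finset.add_sum_erase _ _ (Finset.mem_univ l), ← hc, ← nsmul_eq_mul, ← Finset.sum_const]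
  congr 1
  · have := norm_mul_mk_of_parentLetter_eq hl
    rw [← _root_.map_mul, radial_apply hι, if_pos (by omega), show norm (h * mk [l]) = j by omega]
  · refine Finset.sum_congr rfl fun m hm => ?_
    have := norm_mul_mk_of_parentLetter_ne (x := h) (l := m)
      (by rw [hl]; simpa [eq_comm] using hm)
    rw [← _root_.map_mul, radial_apply hι, if_pos (by omega),
      show norm (h * mk [m]) = j + 2 by omega]

theorem four_mul_le_sq_of_norm_le [Nonempty β] (hι : Function.Injective ι)
    (T : lp (fun _ : G => ℂ) 2 → lp (fun _ : G => ℂ) 2) {K : ℝ} (hK : ∀ f, ‖T f‖ ≤ K * ‖f‖)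
    (hT : ∀ (f : lp (fun _ : G => ℂ) 2) (a : G → ℝ), (∀ x, 0 ≤ a x) → (∀ x, f x = a x) →
      ∀ x, ∑ l : β × Bool, a (x * ι (mk [l])) ≤ ‖T f x‖) :
    4 * (2 * Fintype.card β - 1 : ℝ) ≤ K ^ 2 := by
  classical
  set q : ℝ := 2 * Fintype.card β - 1 with hq
  have hq1 : 1 ≤ q := by
    have : (1 : ℝ) ≤ Fintype.card β := by exact_mod_cast Fintype.card_pos
    linarith
  set t : ℝ := (√q)⁻¹ with ht
  have ht0 : 0 < t := by positivity
  have htq : t ^ 2 * q = 1 := by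
    rw [ht, inv_pow, Real.sq_sqrt (by linarith), inv_mul_cancel₀ (by linarith)]
  set c : ℝ := 2 * Fintype.card β * t ^ 2 with hc
  have hc1 : 1 ≤ c := by nlinarith [sq_nonneg t]
  have key (N : ℕ) : 4 * q * (N * c) ≤ K ^ 2 * (1 + (N + 1) * c) := by
    have hsum := hasSum_radial_sq hι t (N + 1)
    let f : lp (fun _ : G => ℂ) 2 := ⟨fun x => (radial ι t (N + 1) x : ℂ),
      memℓp_two_of_summable (by simpa using hsum.summable)⟩
    have hf : ‖f‖ ^ 2 = 1 + (N + 1) * c := by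
      rw [norm_sq_eq_tsum]
      have h1 : (fun x => ‖f x‖ ^ 2) = fun x => radial ι t (N + 1) x ^ 2 := by
        ext x
        simp [f]
      rw [h1, hsum.tsum_eq, Finset.sum_range_succ', Finset.sum_congr rfl fun j _ =>
        card_sphere_mul_pow htq j, card_sphere_zero]
      simp [← hc, add_comm]
    have hpt : ∀ j ∈ Finset.range N, ∀ h ∈ sphere β (j + 1),
        4 * q * (t ^ (j + 1)) ^ 2 ≤ ‖T f (ι h)‖ ^ 2 := by
      intro j hj h hh
      rw [Finset.mem_range] at hj
      have h1 := hT f (radial ι t (N + 1)) (radial_nonneg hι ht0.le _) (fun x => rfl) (ι h)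
      rw [le_sum_radial hι (by omega) (mem_sphere.1 hh), ← hq] at h1
      have h2 : t ^ j + q * t ^ (j + 2) = 2 * t ^ j := by
        linear_combination t ^ j * htq
      rw [h2] at h1
      have h3 : 4 * q * (t ^ (j + 1)) ^ 2 = (2 * t ^ j) ^ 2 := by
        linear_combination 4 * (t ^ j) ^ 2 * htq
      rw [h3]
      gcongr
    have hle : 4 * q * (N * c) ≤ ‖T f‖ ^ 2 := by
      calc 4 * q * (N * c)
          = ∑ j ∈ Finset.range N, ∑ h ∈ sphere β (j + 1), 4 * q * (t ^ (j + 1)) ^ 2 := by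
            simp only [Finset.sum_const, nsmul_eq_mul]
            rw [Finset.sum_congr rfl fun j _ => by
              rw [mul_left_comm, card_sphere_mul_pow htq j, ← hc]]
            simp [mul_left_comm]
        _ ≤ ∑ j ∈ Finset.range N, ∑ h ∈ sphere β (j + 1), ‖T f (ι h)‖ ^ 2 :=
            Finset.sum_le_sum fun j hj => Finset.sum_le_sum fun h hh => hpt j hj h hh
        _ = ∑ h ∈ (Finset.range N).biUnion (fun j => sphere β (j + 1)), ‖T f (ι h)‖ ^ 2 := by
            rw [Finset.sum_biUnion]
            exact fun _ _ _ _ hij => pairwiseDisjoint_sphere Set.univ (Set.mem_univ _)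
              (Set.mem_univ _) (by simpa using hij)
        _ ≤ ∑' h, ‖T f (ι h)‖ ^ 2 :=
            ((summable_norm_sq (T f)).comp_injective hι).sum_le_tsum _ fun _ _ => sq_nonneg _
        _ ≤ ∑' x, ‖T f x‖ ^ 2 := tsum_comp_le_tsum_of_inj (summable_norm_sq (T f))
            (fun _ => sq_nonneg _) hι
        _ = ‖T f‖ ^ 2 := (norm_sq_eq_tsum _).symm
    rw [← hf, ← mul_pow]
    exact hle.trans (by gcongr; exact hK f)
  by_contra! hlt
  obtain ⟨N, hN⟩ := exists_nat_gt (2 * K ^ 2 / (4 * q - K ^ 2))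
  rw [div_lt_iff₀ (by linarith)] at hN
  have := key N
  nlinarith [sq_nonneg K, mul_le_mul_of_nonneg_left hc1 (sq_nonneg K)]

end RightTranslation

namespace SurfaceGroup

open RightTranslation

theorem ofFree_mk {m : ℕ} (j : Fin m) (w b : Bool) :
    ofFree m (FreeGroup.mk [((j, w), b)]) = sgenFun (m + 1) (j.castSucc, w, !b) := by
  cases b <;> simp [ofFree, sgenFun]

theorem sum_Sgen {m : ℕ} {E : Type*} [AddCommMonoid E] (F : SurfaceGroup (m + 1) → E) :
    ∑ s ∈ Sgen (m + 1), F s =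
      ∑ l : (Fin m × Bool) × Bool, F (ofFree m (FreeGroup.mk [l])) +
        ∑ p : Bool × Bool, F (sgenFun (m + 1) (Fin.last m, p)) := by
  classical
  rw [Sgen, Finset.sum_image (sgenFun_injective _).injOn, Fintype.sum_prod_type,
    Fin.sum_univ_castSucc]
  simp only [Fintype.sum_prod_type, ofFree_mk, Fintype.sum_bool, Bool.not_true, Bool.not_false]
  congr 1
  exact Finset.sum_congr rfl fun j _ => by ac_rfl

theorem smul_markov_apply {m : ℕ}
    {M : lp (fun _ : SurfaceGroup (m + 1) => ℂ) 2 →L[ℂ] lp (fun _ : SurfaceGroup (m + 1) => ℂ) 2}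
    (hM : IsMarkov (m + 1) M) (f : lp (fun _ : SurfaceGroup (m + 1) => ℂ) 2) :
    (4 * ((m + 1 : ℕ) : ℂ)) • M f =
      ∑ l : (Fin m × Bool) × Bool, rtrans (ofFree m (FreeGroup.mk [l])) f +
        ∑ p : Bool × Bool, rtrans (sgenFun (m + 1) (Fin.last m, p)) f := by
  have h0 : (4 * ((m + 1 : ℕ) : ℂ)) ≠ 0 := by
    exact mul_ne_zero (by norm_num) (Nat.cast_ne_zero.2 (Nat.succ_ne_zero m))
  ext x
  rw [lp.coeFn_smul, Pi.smul_apply, hM, smul_eq_mul, mul_inv_cancel_left₀ h0, sum_Sgen,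
    lp.coeFn_add, Pi.add_apply, lp.coeFn_sum, lp.coeFn_sum, Finset.sum_apply, Finset.sum_apply]
  rfl

theorem norm_four_mul_succ_smul {m : ℕ} {E : Type*} [NormedAddCommGroup E] [NormedSpace ℂ E] (v : E) :
    ‖(4 * ((m + 1 : ℕ) : ℂ)) • v‖ = 4 * (m + 1) * ‖v‖ := by
  rw [norm_smul, norm_mul, Complex.norm_natCast]
  norm_num

theorem norm_markov_le {m : ℕ}
    {M : lp (fun _ : SurfaceGroup (m + 1) => ℂ) 2 →L[ℂ] lp (fun _ : SurfaceGroup (m + 1) => ℂ) 2}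
    (hM : IsMarkov (m + 1) M) : 4 * (m + 1) * ‖M‖ ≤ 4 * √m + 4 := by
  have h (f : lp (fun _ : SurfaceGroup (m + 1) => ℂ) 2) :
      4 * (m + 1) * ‖M f‖ ≤ (4 * √m + 4) * ‖f‖ := by
    rw [← norm_four_mul_succ_smul, smul_markov_apply hM]
    have h1 := norm_sum_rtrans_freeGroup_le (ofFree_injective m) f
    have h2 : ‖∑ p : Bool × Bool, rtrans (sgenFun (m + 1) (Fin.last m, p)) f‖ ≤ 4 * ‖f‖ := by
      refine (norm_sum_le _ _).trans_eq ?_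
      simp only [norm_rtrans, Finset.sum_const, nsmul_eq_mul]
      norm_num
    have h3 : √(2 * (Fintype.card (Fin m × Bool) : ℝ)) = 2 * √m := by
      rw [Fintype.card_prod, Fintype.card_bool, Fintype.card_fin, Nat.cast_mul,
        show (2 : ℝ) * (m * (2 : ℕ)) = 2 ^ 2 * m by push_cast; ring, Real.sqrt_mul (by norm_num),
        Real.sqrt_sq (by norm_num)]
    rw [h3] at h1
    refine (norm_add_le _ _).trans ?_
    linarith
  have hm : (0 : ℝ) < 4 * (m + 1) := by positivity
  rw [← le_div_iff₀' hm]
  refine M.opNorm_le_bound (by positivity) fun f => ?_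
  rw [div_mul_eq_mul_div, le_div_iff₀' hm]
  exact h f

theorem le_norm_markov {m : ℕ} (hm : m ≠ 0)
    {M : lp (fun _ : SurfaceGroup (m + 1) => ℂ) 2 →L[ℂ] lp (fun _ : SurfaceGroup (m + 1) => ℂ) 2}
    (hM : IsMarkov (m + 1) M) : 4 * (4 * m - 1) ≤ (4 * (m + 1) * ‖M‖) ^ 2 := by
  have : NeZero m := ⟨hm⟩
  have h := four_mul_le_sq_of_norm_le (ofFree_injective m)
    (fun f => (4 * ((m + 1 : ℕ) : ℂ)) • M f) (K := 4 * (m + 1) * ‖M‖)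
    (fun f => by
      rw [norm_four_mul_succ_smul, mul_assoc _ ‖M‖]
      gcongr
      exact M.le_opNorm f)
    (fun f a ha hf x => by
      rw [smul_markov_apply hM, lp.coeFn_add, Pi.add_apply, lp.coeFn_sum, lp.coeFn_sum, Finset.sum_apply,
        Finset.sum_apply]
      simp only [rtrans_apply, hf]
      rw [← Complex.ofReal_sum, ← Complex.ofReal_sum, ← Complex.ofReal_add, Complex.norm_real,
        Real.norm_eq_abs]
      exact (le_add_of_nonneg_right (Finset.sum_nonneg fun _ _ => ha _)).trans (le_abs_self _))
  refine le_trans (le_of_eq ?_) h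
  simp
  ring

end SurfaceGroup

/-- `μ_g = g^{-1/2} + O(g^{-1})`: there is a constant `C > 0` such that
`|μ_g − 1/√g| ≤ C/g` for every `g ≥ 2`. -/
theorem mu_asymptotic :
    ∃ C : ℝ, 0 < C ∧ ∀ g : ℕ, 2 ≤ g →
      ∀ M : lp (fun _ : SurfaceGroup g => ℂ) 2 →L[ℂ] lp (fun _ : SurfaceGroup g => ℂ) 2,
        IsMarkov g M → |‖M‖ - 1 / Real.sqrt g| ≤ C / g := by
  refine ⟨3, by norm_num, fun g hg M hM => ?_⟩
  obtain ⟨m, rfl⟩ : ∃ m, g = m + 1 := ⟨g - 1, by omega⟩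
  have hm : (1 : ℝ) ≤ m := by exact_mod_cast (by omega : 1 ≤ m)
  have hup := SurfaceGroup.norm_markov_le hM
  have hlow := SurfaceGroup.le_norm_markov (by omega) hM
  push_cast
  have hpos : (0 : ℝ) < m + 1 := by positivity
  set r := √((m : ℝ) + 1) with hr
  have hr2 : r ^ 2 = m + 1 := Real.sq_sqrt hpos.le
  have hr0 : 0 < r := Real.sqrt_pos.2 hpos
  have hmr : √(m : ℝ) ≤ r := Real.sqrt_le_sqrt (by linarith)
  have hinv : 1 / r = r / (m + 1) := by
    rw [← hr2]
    field_simp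
  have hnonneg : 0 ≤ (m + 1) * ‖M‖ := by positivity
  have hlow' : r - 3 ≤ (m + 1) * ‖M‖ := by
    by_contra! h
    nlinarith
  have hdiff : ‖M‖ - r / (m + 1) = ((m + 1) * ‖M‖ - r) / (m + 1) := by field_simp
  rw [hinv, hdiff, abs_div, abs_of_pos hpos]
  gcongr
  rw [abs_le]
  constructor <;> linarith
end
end

section
/- For every integer g ≥ 2 one has 0 < δ_g < ε_g < π/(4g). -/
open scoped Real

noncomputable section

/-- The inverse hyperbolic cosine, `arcosh x = log (x + √(x² − 1))`. -/
def arcosh (x : ℝ) : ℝ := Real.log (x + Real.sqrt (x ^ 2 - 1))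

/-- `D_g = 2 arccosh (cot (π/(4g)))`. -/
def Dg (g : ℕ) : ℝ := 2 * arcosh (Real.tan (π / (4 * g)))⁻¹

/-- `C_g = cosh D_g`. -/
def Cg (g : ℕ) : ℝ := Real.cosh (Dg g)

/-- `σ_g = sinh D_g`. -/
def Sinhg (g : ℕ) : ℝ := Real.sinh (Dg g)

/-- `δ_g = arccos (σ_g / C_g)`. -/
def deltag (g : ℕ) : ℝ := Real.arccos (Sinhg g / Cg g)

/-- `ε_g = arccos (σ_g / C_g − 1/(σ_g C_g))`. -/
def epsg (g : ℕ) : ℝ := Real.arccos (Sinhg g / Cg g - 1 / (Sinhg g * Cg g))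

theorem arcosh_eq_real_arcosh (x : ℝ) : arcosh x = Real.arcosh x := rfl

theorem cosh_two_mul_arcosh {x : ℝ} (hx : 1 ≤ x) :
    Real.cosh (2 * arcosh x) = 2 * x ^ 2 - 1 := by
  rw [arcosh_eq_real_arcosh, Real.cosh_two_mul, Real.sinh_sq, Real.cosh_arcosh hx]
  ring

theorem sinh_two_mul_arcosh_pos {x : ℝ} (hx : 1 < x) : 0 < Real.sinh (2 * arcosh x) := by
  rw [arcosh_eq_real_arcosh, Real.sinh_pos_iff]
  linarith [Real.arcosh_pos hx]

/-- An angle of at most `π / 8` has cotangent larger than `2`. -/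
theorem two_lt_inv_tan {a : ℝ} (ha : 0 < a) (ha' : a ≤ π / 8) : 2 < (Real.tan a)⁻¹ := by
  have hsin : 0 < Real.sin a := Real.sin_pos_of_pos_of_lt_pi ha (by linarith [Real.pi_pos])
  have hcos : 0 < Real.cos a :=
    Real.cos_pos_of_mem_Ioo ⟨by linarith [Real.pi_pos], by linarith [Real.pi_pos]⟩
  have hdouble : √2 / 2 ≤ Real.cos (2 * a) := by
    rw [← Real.cos_pi_div_four]
    exact Real.cos_le_cos_of_nonneg_of_le_pi (by linarith) (by linarith [Real.pi_pos])
      (by linarith)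
  have hsqrt : (1.4 : ℝ) < √2 := Real.lt_sqrt_of_sq_lt (by norm_num)
  rw [Real.cos_two_mul] at hdouble
  have hsq := Real.sin_sq_add_cos_sq a
  rw [Real.tan_eq_sin_div_cos, inv_div, lt_div_iff₀ hsin]
  nlinarith

/-- If `x = cot a`, then `cos² a = x² / (1 + x²)`, written through `C = 2 x² - 1`. -/
theorem cos_sq_mul_eq {a : ℝ} (hsin : Real.sin a ≠ 0) :
    Real.cos a ^ 2 * ((2 * (Real.tan a)⁻¹ ^ 2 - 1) + 3) = (2 * (Real.tan a)⁻¹ ^ 2 - 1) + 1 := by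
  rw [Real.tan_eq_sin_div_cos, inv_div]
  field_simp
  linear_combination (2 * Real.cos a ^ 2) * Real.sin_sq_add_cos_sq a

/-- The inequality between cosines behind `ε_g < π / (4 g)`. -/
theorem lt_div_sub_of_sq_mul_eq {C s c : ℝ} (hC : 7 < C) (hs : 0 < s) (hsq : C ^ 2 - s ^ 2 = 1)
    (hcos : c ^ 2 * (C + 3) = C + 1) : c < s / C - 1 / (s * C) := by
  have hC0 : 0 < C := by linarith
  have heq : s / C - 1 / (s * C) = (s ^ 2 - 1) / (s * C) := by
    field_simp
  rw [heq, lt_div_iff₀ (by positivity)]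
  refine lt_of_pow_lt_pow_left₀ 2 (by nlinarith) ?_
  have hs2 : s ^ 2 = C ^ 2 - 1 := by linarith
  refine lt_of_mul_lt_mul_right ?_ (by linarith : 0 ≤ C + 3)
  have hl : (c * (s * C)) ^ 2 * (C + 3) = (C + 1) * ((C ^ 2 - 1) * C ^ 2) := by
    rw [← hcos, ← hs2]
    ring
  rw [hl, hs2]
  obtain ⟨d, hd, rfl⟩ : ∃ d : ℝ, 0 < d ∧ C = d + 7 := ⟨C - 7, by linarith, by ring⟩
  rw [← sub_pos]
  ring_nf
  positivity

/-- Inequality (9) of Lemma 4: `0 < δ_g < ε_g < π/(4g)` for every `g ≥ 2`. -/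
theorem delta_lt_eps_lt (g : ℕ) (hg : 2 ≤ g) :
    0 < deltag g ∧ deltag g < epsg g ∧ epsg g < π / (4 * g) := by
  have hg' : (2 : ℝ) ≤ g := by exact_mod_cast hg
  have hpi := Real.pi_pos
  have ha : 0 < π / (4 * g) := by positivity
  have ha' : π / (4 * g) ≤ π / 8 := by gcongr; linarith
  have hx := two_lt_inv_tan ha ha'
  have hsin := Real.sin_pos_of_pos_of_lt_pi ha (by linarith)
  have hcosh : Cg g = 2 * (Real.tan (π / (4 * g)))⁻¹ ^ 2 - 1 :=
    cosh_two_mul_arcosh (by linarith)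
  have hC : 7 < Cg g := by
    rw [hcosh]
    nlinarith
  have hs : 0 < Sinhg g := sinh_two_mul_arcosh_pos (by linarith)
  have hsq : Cg g ^ 2 - Sinhg g ^ 2 = 1 := Real.cosh_sq_sub_sinh_sq _
  have hcos := cos_sq_mul_eq hsin.ne'
  rw [← hcosh] at hcos
  have hlt := lt_div_sub_of_sq_mul_eq hC hs hsq hcos
  have hratio : Sinhg g / Cg g < 1 := (div_lt_one (by linarith)).2 (Real.sinh_lt_cosh _)
  have hinv : 0 < 1 / (Sinhg g * Cg g) := by positivity
  have hneg := Real.neg_one_le_cos (π / (4 * g))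
  refine ⟨Real.arccos_pos.2 hratio,
    Real.arccos_lt_arccos (by linarith) (by linarith) hratio.le, ?_⟩
  calc epsg g < Real.arccos (Real.cos (π / (4 * g))) :=
        Real.arccos_lt_arccos hneg hlt (by linarith)
    _ = π / (4 * g) := Real.arccos_cos ha.le (by linarith)
end
end

section
/- Let g ≥ 2 be an integer, let ν ≥ 0 be a real number, and let β : ℝ → ℝ be defined by β(φ) = (C_g − σ_g·cos φ)^{−ν}. Then the first derivative satisfies β'(φ) ≤ 0 for all φ ∈ [0, π], the second derivative satisfies β''(φ) ≥ 0 for all φ ∈ [δ_g, π], and the third derivative satisfies β'''(φ) ≤ 0 for all φ ∈ [ε_g, π]. -/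
open scoped Real

noncomputable section

lemma Dg_nonneg {g : ℕ} (hg : 1 ≤ g) : 0 ≤ Dg g := by
  have hg' : (1 : ℝ) ≤ g := by exact_mod_cast hg
  have hpos : 0 < π / (4 * g) := by positivity
  have hle : π / (4 * g) ≤ π / 4 := by
    gcongr
    linarith
  have htan : 0 < Real.tan (π / (4 * g)) :=
    Real.tan_pos_of_pos_of_lt_pi_div_two hpos (by linarith [Real.pi_pos])
  have htan_le : Real.tan (π / (4 * g)) ≤ 1 := by
    rw [← Real.tan_pi_div_four]
    exact Real.strictMonoOn_tan.monotoneOn ⟨by linarith [Real.pi_pos], by linarith [Real.pi_pos]⟩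
      ⟨by linarith [Real.pi_pos], by linarith [Real.pi_pos]⟩ hle
  have hone : 1 ≤ (Real.tan (π / (4 * g)))⁻¹ := (one_le_inv₀ htan).2 htan_le
  unfold Dg arcosh
  refine mul_nonneg zero_le_two (Real.log_nonneg ?_)
  linarith [Real.sqrt_nonneg ((Real.tan (π / (4 * g)))⁻¹ ^ 2 - 1)]

lemma sub_mul_cos_pos {C S : ℝ} (hS : 0 ≤ S) (hSC : S < C) (φ : ℝ) : 0 < C - S * Real.cos φ := by
  nlinarith [Real.cos_le_one φ]

lemma hasDerivAt_sub_mul_cos_rpow {C S : ℝ} (hS : 0 ≤ S) (hSC : S < C) (p φ : ℝ) :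
    HasDerivAt (fun φ => (C - S * Real.cos φ) ^ p)
      (p * S * Real.sin φ * (C - S * Real.cos φ) ^ (p - 1)) φ := by
  have h : HasDerivAt (fun φ => C - S * Real.cos φ) (S * Real.sin φ) φ := by
    simpa using ((Real.hasDerivAt_cos φ).const_mul S).const_sub C
  convert h.rpow_const (p := p) (Or.inl (sub_mul_cos_pos hS hSC φ).ne') using 1
  ring

lemma deriv_sub_mul_cos_rpow {C S : ℝ} (hS : 0 ≤ S) (hSC : S < C) (ν : ℝ) :
    deriv (fun φ => (C - S * Real.cos φ) ^ (-ν)) =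
      fun φ => -(ν * S * Real.sin φ * (C - S * Real.cos φ) ^ (-ν - 1)) := by
  funext φ
  rw [(hasDerivAt_sub_mul_cos_rpow hS hSC (-ν) φ).deriv]
  ring

lemma deriv_deriv_sub_mul_cos_rpow {C S : ℝ} (hS : 0 ≤ S) (hSC : S < C) (ν : ℝ) :
    deriv (deriv fun φ => (C - S * Real.cos φ) ^ (-ν)) =
      fun φ => ν * S * (ν * S * Real.sin φ ^ 2 + S - C * Real.cos φ) *
        (C - S * Real.cos φ) ^ (-ν - 2) := by
  rw [deriv_sub_mul_cos_rpow hS hSC]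
  funext φ
  have h := (((Real.hasDerivAt_sin φ).const_mul (ν * S)).mul
    (hasDerivAt_sub_mul_cos_rpow hS hSC (-ν - 1) φ)).neg
  refine h.deriv.trans ?_
  have hy := sub_mul_cos_pos hS hSC φ
  have e : (C - S * Real.cos φ) ^ (-ν - 1) =
      (C - S * Real.cos φ) ^ (-ν - 2) * (C - S * Real.cos φ) := by
    rw [← Real.rpow_add_one hy.ne']
    ring_nf
  rw [e, show -ν - 1 - 1 = -ν - 2 by ring]
  linear_combination (ν * S ^ 2 * (C - S * Real.cos φ) ^ (-ν - 2)) * Real.sin_sq_add_cos_sq φ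

lemma deriv_deriv_deriv_sub_mul_cos_rpow {C S : ℝ} (hS : 0 ≤ S) (hSC : S < C)
    (ν φ : ℝ) :
    deriv (deriv (deriv fun φ => (C - S * Real.cos φ) ^ (-ν))) φ =
      ν * S * Real.sin φ * (C ^ 2 - 2 * S ^ 2 + S * C * Real.cos φ
        + 3 * ν * S * (C * Real.cos φ - S) - ν ^ 2 * S ^ 2 * Real.sin φ ^ 2) *
        (C - S * Real.cos φ) ^ (-ν - 3) := by
  rw [deriv_deriv_sub_mul_cos_rpow hS hSC]
  have h := ((((((Real.hasDerivAt_sin φ).pow 2).const_mul (ν * S)).add_const S).sub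
    ((Real.hasDerivAt_cos φ).const_mul C)).const_mul (ν * S)).mul
    (hasDerivAt_sub_mul_cos_rpow hS hSC (-ν - 2) φ)
  refine h.deriv.trans ?_
  have hy := sub_mul_cos_pos hS hSC φ
  have e : (C - S * Real.cos φ) ^ (-ν - 2) =
      (C - S * Real.cos φ) ^ (-ν - 3) * (C - S * Real.cos φ) := by
    rw [← Real.rpow_add_one hy.ne']
    ring_nf
  simp only [Pi.sub_apply, Pi.pow_apply]
  rw [e, show -ν - 2 - 1 = -ν - 3 by ring]
  push_cast
  linear_combination (-2 * ν ^ 2 * S ^ 3 * Real.sin φ * (C - S * Real.cos φ) ^ (-ν - 3)) *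
    Real.sin_sq_add_cos_sq φ

lemma cos_le_of_arccos_le {x φ : ℝ} (hx : -1 ≤ x) (h : Real.arccos x ≤ φ) (hφ : φ ≤ π) :
    Real.cos φ ≤ x := by
  have h' := Real.cos_le_cos_of_nonneg_of_le_pi (Real.arccos_nonneg x) hφ h
  rcases le_total x 1 with hx1 | hx1
  · rwa [Real.cos_arccos hx hx1] at h'
  · exact (Real.cos_le_one φ).trans hx1

/-- Lemma 4: for `β(φ) = (C_g − σ_g cos φ)^{−ν}` with `ν ≥ 0`, one has `β' ≤ 0` on
`[0, π]`, `β'' ≥ 0` on `[δ_g, π]` and `β''' ≤ 0` on `[ε_g, π]`. -/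
theorem beta_derivative_signs (g : ℕ) (hg : 2 ≤ g) (ν : ℝ) (hν : 0 ≤ ν)
    (β : ℝ → ℝ) (hβ : β = fun φ => (Cg g - Sinhg g * Real.cos φ) ^ (-ν)) :
    (∀ φ ∈ Set.Icc (0 : ℝ) π, deriv β φ ≤ 0) ∧
    (∀ φ ∈ Set.Icc (deltag g) π, 0 ≤ deriv (deriv β) φ) ∧
    (∀ φ ∈ Set.Icc (epsg g) π, deriv (deriv (deriv β)) φ ≤ 0) := by
  have hS : 0 ≤ Sinhg g := Real.sinh_nonneg_iff.2 (Dg_nonneg (by omega))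
  have hSC : Sinhg g < Cg g := Real.sinh_lt_cosh _
  have hsq : Cg g ^ 2 = Sinhg g ^ 2 + 1 := Real.cosh_sq _
  unfold deltag epsg
  generalize Sinhg g = S at *
  generalize Cg g = C at *
  have hC : 0 < C := hS.trans_lt hSC
  have hpow (φ p : ℝ) : 0 ≤ (C - S * Real.cos φ) ^ p :=
    Real.rpow_nonneg (sub_mul_cos_pos hS hSC φ).le p
  subst hβ
  refine ⟨fun φ hφ => ?_, fun φ hφ => ?_, fun φ hφ => ?_⟩
  · rw [deriv_sub_mul_cos_rpow hS hSC]
    have hsin := Real.sin_nonneg_of_nonneg_of_le_pi hφ.1 hφ.2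
    have := hpow φ (-ν - 1)
    exact neg_nonpos.2 (by positivity)
  · rw [deriv_deriv_sub_mul_cos_rpow hS hSC]
    have hcos : Real.cos φ ≤ S / C :=
      cos_le_of_arccos_le (by linarith [div_nonneg hS hC.le]) hφ.1 hφ.2
    rw [le_div_iff₀ hC] at hcos
    have hbracket : 0 ≤ ν * S * Real.sin φ ^ 2 + S - C * Real.cos φ := by
      have : 0 ≤ ν * S * Real.sin φ ^ 2 := by positivity
      linarith
    exact mul_nonneg (mul_nonneg (mul_nonneg hν hS) hbracket) (hpow φ _)
  · rw [deriv_deriv_deriv_sub_mul_cos_rpow hS hSC]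
    rcases hS.eq_or_lt with rfl | hS'
    · simp
    rcases lt_or_ge (S / C - 1 / (S * C)) (-1) with hx | hx
    · have hπ : φ = π := le_antisymm hφ.2 (Real.arccos_of_le_neg_one hx.le ▸ hφ.1)
      simp [hπ]
    have hsin := Real.sin_nonneg_of_nonneg_of_le_pi ((Real.arccos_nonneg _).trans hφ.1) hφ.2
    have hcos := cos_le_of_arccos_le hx hφ.1 hφ.2
    have hcos' : S * C * Real.cos φ ≤ S ^ 2 - 1 := by
      calc S * C * Real.cos φ ≤ S * C * (S / C - 1 / (S * C)) := by gcongr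
        _ = S ^ 2 - 1 := by field_simp
    have hbracket : C ^ 2 - 2 * S ^ 2 + S * C * Real.cos φ
        + 3 * ν * S * (C * Real.cos φ - S) - ν ^ 2 * S ^ 2 * Real.sin φ ^ 2 ≤ 0 := by
      have h₁ : 0 ≤ ν ^ 2 * S ^ 2 * Real.sin φ ^ 2 := by positivity
      have h₂ : 0 ≤ ν * (S ^ 2 - S * C * Real.cos φ) := mul_nonneg hν (by linarith)
      linarith
    exact mul_nonpos_of_nonpos_of_nonneg
      (mul_nonpos_of_nonneg_of_nonpos (by positivity) hbracket) (hpow φ _)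
end
end

section
/- Let ρ > 0 and let φ ∈ ℝ with sin φ ≠ 0. If real numbers a, b satisfy a² + (b − cosh ρ)² = (sinh ρ)² and (a − cos φ/sin φ)² + b² = 1 + (cos φ/sin φ)², then b = 1/(cosh ρ − sinh ρ · cos φ) or b = 1/(cosh ρ + sinh ρ · cos φ). -/
noncomputable section

/-- Intersection of a hyperbolic circle of radius `ρ` centred at `i` with a geodesic
through `i` of angle `φ` in the Poincaré half-plane: if `a² + (b − cosh ρ)² = sinh² ρ`
and `(a − cot φ)² + b² = 1 + cot² φ`, then `b = 1/(cosh ρ − sinh ρ cos φ)` or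
`b = 1/(cosh ρ + sinh ρ cos φ)`. -/
theorem circle_geodesic_intersection (ρ φ : ℝ) (hρ : 0 < ρ) (hφ : Real.sin φ ≠ 0)
    (a b : ℝ)
    (h1 : a ^ 2 + (b - Real.cosh ρ) ^ 2 = Real.sinh ρ ^ 2)
    (h2 : (a - Real.cos φ / Real.sin φ) ^ 2 + b ^ 2
        = 1 + (Real.cos φ / Real.sin φ) ^ 2) :
    b = (Real.cosh ρ - Real.sinh ρ * Real.cos φ)⁻¹ ∨
      b = (Real.cosh ρ + Real.sinh ρ * Real.cos φ)⁻¹ := by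
  have hC : Real.cosh ρ ^ 2 = Real.sinh ρ ^ 2 + 1 := Real.cosh_sq ρ
  have hs : Real.sin φ ^ 2 = 1 - Real.cos φ ^ 2 := Real.sin_sq φ
  have hchord : Real.sin φ * (b * Real.cosh ρ - 1) = a * Real.cos φ := by
    field_simp at h2
    apply mul_left_cancel₀ hφ
    linear_combination h2 / 2 - Real.sin φ ^ 2 / 2 * (h1 - hC)
  have hsq : (b * Real.cosh ρ - 1) ^ 2 = (b * Real.sinh ρ * Real.cos φ) ^ 2 := by
    linear_combination (Real.sin φ * (b * Real.cosh ρ - 1) + a * Real.cos φ) * hchord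
      + Real.cos φ ^ 2 * (h1 - hC) - (b * Real.cosh ρ - 1) ^ 2 * hs
      + Real.cos φ ^ 2 * b ^ 2 * hC
  rcases sq_eq_sq_iff_eq_or_eq_neg.mp hsq with h | h
  · exact Or.inl (eq_inv_of_mul_eq_one_left (by linear_combination h))
  · exact Or.inr (eq_inv_of_mul_eq_one_left (by linear_combination h))
end
end
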